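/- arXiv:1306.2774 — 18 statements merged into one kernel-verified Lean document; each statement's English description precedes it below -/
import Mathlib

section
/- Let X be a chain. If α and β are regular elements of O(X) (that is, there exist α', β' ∈ O(X) with αα'α = α and ββ'β = β), then the product αβ is a regular element of O(X). Consequently, the set Reg(O(X)) of all regular elements of O(X) is a subsemigroup of O(X), and hence the largest regular subsemigroup of O(X). -/
/-- If a monotone map `f` fixes every point of `Y`, then every section `g` of `f` over `Y`
extends from `Y` to a monotone map on the whole chain. -/
theorem OrderHom.exists_extend_section {X : Type*} [LinearOrder X] (f : X →o X) (Y : Set X)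
    (g : X → X) (hf : ∀ y ∈ Y, f y = y) (hg : ∀ y ∈ Y, f (g y) = y) :
    ∃ h : X →o X, ∀ y ∈ Y, h y = g y := by
  have g_lt : ∀ y ∈ Y, ∀ z ∈ Y, y < z → g y < z := by
    intro y hy z hz hyz
    by_contra! hle
    have := f.monotone hle
    rw [hf z hz, hg y hy] at this
    exact this.not_gt hyz
  have lt_g : ∀ y ∈ Y, ∀ z ∈ Y, y < z → y < g z := by
    intro y hy z hz hyz
    by_contra! hle
    have := f.monotone hle
    rw [hf y hy, hg z hz] at this
    exact this.not_gt hyz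
  have g_mono : ∀ y ∈ Y, ∀ z ∈ Y, y ≤ z → g y ≤ g z := by
    intro y hy z hz hyz
    by_contra! hlt
    have := f.monotone hlt.le
    rw [hg y hy, hg z hz] at this
    exact hlt.ne (congrArg g (this.antisymm hyz))
  -- Each cut of `Y` is filled by the image of an endpoint, or by the point itself if there is none.
  have key : ∀ x, ∃ s, (∃ m, IsGreatest (Y ∩ Set.Iic x) m ∧ s = g m) ∨
      (¬ (∃ m, IsGreatest (Y ∩ Set.Iic x) m) ∧ ∃ m, IsLeast (Y ∩ Set.Ici x) m ∧ s = g m) ∨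
      (¬ (∃ m, IsGreatest (Y ∩ Set.Iic x) m) ∧ ¬ (∃ m, IsLeast (Y ∩ Set.Ici x) m) ∧ s = x) := by
    intro x
    by_cases h₁ : ∃ m, IsGreatest (Y ∩ Set.Iic x) m
    · obtain ⟨m, hm⟩ := h₁
      exact ⟨g m, Or.inl ⟨m, hm, rfl⟩⟩
    by_cases h₂ : ∃ m, IsLeast (Y ∩ Set.Ici x) m
    · obtain ⟨m, hm⟩ := h₂
      exact ⟨g m, Or.inr (Or.inl ⟨h₁, m, hm, rfl⟩)⟩
    · exact ⟨x, Or.inr (Or.inr ⟨h₁, h₂, rfl⟩)⟩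
  have above : ∀ x, ¬ (∃ m, IsGreatest (Y ∩ Set.Iic x) m) → ∀ m ∈ Y, m ≤ x →
      ∃ y ∈ Y, m < y ∧ y ≤ x := by
    intro x hx m hm hmx
    by_contra! hno
    exact hx ⟨m, ⟨hm, hmx⟩, fun y hy => not_lt.1 fun hlt => (hno y hy.1 hlt).not_ge hy.2⟩
  have below : ∀ x, ¬ (∃ m, IsLeast (Y ∩ Set.Ici x) m) → ∀ m ∈ Y, x ≤ m →
      ∃ y ∈ Y, y < m ∧ x ≤ y := by
    intro x hx m hm hxm
    by_contra! hno
    exact hx ⟨m, ⟨hm, hxm⟩, fun y hy => not_lt.1 fun hlt => (hno y hy.1 hlt).not_ge hy.2⟩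
  have le_greatest : ∀ x x' m, x ≤ x' → ¬ (∃ m, IsGreatest (Y ∩ Set.Iic x) m) →
      IsGreatest (Y ∩ Set.Iic x') m → x ≤ m := by
    intro x x' m hxx' hx hm
    by_contra! hlt
    exact hx ⟨m, ⟨hm.1.1, hlt.le⟩, fun y hy => hm.2 ⟨hy.1, le_trans hy.2 hxx'⟩⟩
  choose h hh using key
  refine ⟨⟨h, fun x x' hxx' => ?_⟩, fun y hy => ?_⟩
  · rcases hh x with ⟨m, hm, e⟩ | ⟨hG, m, hm, e⟩ | ⟨hG, hL, e⟩ <;>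
    rcases hh x' with ⟨m', hm', e'⟩ | ⟨hG', m', hm', e'⟩ | ⟨hG', hL', e'⟩ <;> rw [e, e']
    · exact g_mono m hm.1.1 m' hm'.1.1 (hm'.2 ⟨hm.1.1, le_trans hm.1.2 hxx'⟩)
    · exact g_mono m hm.1.1 m' hm'.1.1 (le_trans hm.1.2 (le_trans hxx' hm'.1.2))
    · obtain ⟨y, hy, hmy, hyx⟩ := above x' hG' m hm.1.1 (le_trans hm.1.2 hxx')
      exact (g_lt m hm.1.1 y hy hmy).le.trans hyx
    · exact g_mono m hm.1.1 m' hm'.1.1 (hm.2 ⟨hm'.1.1, le_greatest x x' m' hxx' hG hm'⟩)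
    · exact g_mono m hm.1.1 m' hm'.1.1 (hm.2 ⟨hm'.1.1, le_trans hxx' hm'.1.2⟩)
    · have hmx' : m ≤ x' := by
        by_contra! hlt
        exact hL' ⟨m, ⟨hm.1.1, hlt.le⟩, fun y hy => hm.2 ⟨hy.1, le_trans hxx' hy.2⟩⟩
      obtain ⟨y, hy, hmy, hyx⟩ := above x' hG' m hm.1.1 hmx'
      exact (g_lt m hm.1.1 y hy hmy).le.trans hyx
    · obtain ⟨y, hy, hym, hxy⟩ := below x hL m' hm'.1.1 (le_greatest x x' m' hxx' hG hm')
      exact hxy.trans (lt_g y hy m' hm'.1.1 hym).le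
    · obtain ⟨y, hy, hym, hxy⟩ := below x hL m' hm'.1.1 (le_trans hxx' hm'.1.2)
      exact hxy.trans (lt_g y hy m' hm'.1.1 hym).le
    · exact hxx'
  · have hgr : IsGreatest (Y ∩ Set.Iic y) y := ⟨⟨hy, le_rfl⟩, fun z hz => hz.2⟩
    rcases hh y with ⟨m, hm, e⟩ | ⟨hG, _⟩ | ⟨hG, _⟩
    · exact e.trans (congrArg g (hm.unique hgr))
    · exact absurd ⟨y, hgr⟩ hG
    · exact absurd ⟨y, hgr⟩ hG


/-- If `α` and `β` are regular elements of `O(X)` (the monoid of order-preserving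
self-maps of a chain `X`, with product written left-to-right: `(αβ)(x) = β(α(x))`),
then `αβ` is regular in `O(X)`. Consequently `Reg(O(X))` is a (the largest regular)
subsemigroup of `O(X)`. -/
theorem product_of_regulars_is_regular_in_OX
    {X : Type*} [LinearOrder X] (α β : X →o X)
    (hα : ∃ α' : X →o X, ∀ x, α (α' (α x)) = α x)
    (hβ : ∃ β' : X →o X, ∀ x, β (β' (β x)) = β x) :
    ∃ γ : X →o X, ∀ x, β (α (γ (β (α x)))) = β (α x) := by
  obtain ⟨α', hα⟩ := hα
  obtain ⟨β', hβ⟩ := hβ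
  have hsec : ∀ y, ∃ z, y ∈ Set.range (fun x => β' (β (α x))) →
      α (α' z) = z ∧ β' (β z) = y := by
    intro y
    by_cases hy : y ∈ Set.range (fun x => β' (β (α x)))
    · obtain ⟨x, rfl⟩ := hy
      exact ⟨α x, fun _ => ⟨hα x, rfl⟩⟩
    · exact ⟨y, fun h => absurd h hy⟩
  choose g hg using hsec
  obtain ⟨h, hh⟩ := OrderHom.exists_extend_section (β'.comp β)
    (Set.range fun x => β' (β (α x))) g
    (by rintro _ ⟨x, rfl⟩; exact congrArg β' (hβ (α x))) (fun y hy => (hg y hy).2)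
  refine ⟨α'.comp (h.comp β'), fun x => ?_⟩
  have hy := Set.mem_range_self (f := fun x => β' (β (α x))) x
  obtain ⟨hfix, himg⟩ := hg _ hy
  change β (α (α' (h (β' (β (α x)))))) = β (α x)
  rw [hh _ hy, hfix, ← hβ (g _), himg, hβ]
end

section
/- Let X be a chain, let Y be a nonempty subset of X, and let α, β ∈ O(X,Y). Then α 𝓛 β in O(X,Y) if and only if either α = β, or α, β ∈ FO(X,Y) and range(α) = range(β). -/
/-- If every value of `α` is attained by `β` on `Y`, then `α` factors through `β` by an
order-preserving map into `Y`. -/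
theorem OrderHom.exists_comp_eq_of_range_subset_image {X Z W : Type*} [LinearOrder X]
    [PartialOrder Z] [Preorder W] {Y : Set X} (α : W →o Z) (β : X →o Z)
    (h : Set.range α ⊆ β '' Y) :
    ∃ lam : W →o X, (∀ x, lam x ∈ Y) ∧ ∀ x, β (lam x) = α x := by
  choose s hsY hs using fun z : Set.range α => h z.2
  have hmono : Monotone s := fun z w hzw => by
    by_contra! hlt
    have hle := β.monotone hlt.le
    rw [hs, hs] at hle
    exact hlt.ne (congrArg s (Subtype.ext (le_antisymm hle hzw)))
  exact ⟨⟨fun x => s ⟨α x, x, rfl⟩, fun _ _ hab => hmono (α.monotone hab)⟩,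
    fun _ => hsY _, fun _ => hs _⟩

/-- If `α` and `β` factor through each other by maps into `Y`, then every value of `α` is
attained on `Y`. -/
theorem Set.range_eq_image_of_comp_eq {X Z : Type*} {Y : Set X} {α β : X → Z}
    {lam mu : X → X} (hmu : ∀ x, mu x ∈ Y) (hα : ∀ x, β (lam x) = α x)
    (hβ : ∀ x, α (mu x) = β x) : Set.range α = α '' Y := by
  refine (Set.range_subset_iff.2 fun x => ?_).antisymm (Set.image_subset_range α Y)
  exact ⟨mu (lam x), hmu _, by rw [hβ, hα]⟩

/-- Green's relation 𝓛 on `O(X,Y)`: for `α, β ∈ O(X,Y)`,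
`α 𝓛 β` iff `α = β`, or `α, β ∈ FO(X,Y)` and `range α = range β`.
Here `O(X,Y)` is modeled by order-preserving maps `X →o X` with range contained in `Y`,
the product is written left-to-right (`(αβ)(x) = β(α(x))`), and
`FO(X,Y) = {α : range α = α(Y)}`. -/
theorem green_L_on_OXY
    {X : Type*} [LinearOrder X] (Y : Set X) (hY : Y.Nonempty)
    (α β : X →o X) (hα : ∀ x, α x ∈ Y) (hβ : ∀ x, β x ∈ Y) :
    (α = β ∨
      ((∃ lam : X →o X, (∀ x, lam x ∈ Y) ∧ ∀ x, β (lam x) = α x) ∧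
       (∃ mu : X →o X, (∀ x, mu x ∈ Y) ∧ ∀ x, α (mu x) = β x))) ↔
    (α = β ∨
      (Set.range ⇑α = ⇑α '' Y ∧ Set.range ⇑β = ⇑β '' Y ∧
       Set.range ⇑α = Set.range ⇑β)) := by
  refine or_congr_right ⟨?_, ?_⟩
  · rintro ⟨⟨lam, hlam, hα'⟩, mu, hmu, hβ'⟩
    refine ⟨Set.range_eq_image_of_comp_eq hmu hα' hβ',
      Set.range_eq_image_of_comp_eq hlam hβ' hα', ?_⟩
    exact Set.Subset.antisymm (Set.range_subset_iff.2 fun x => ⟨lam x, hα' x⟩)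
      (Set.range_subset_iff.2 fun x => ⟨mu x, hβ' x⟩)
  · rintro ⟨hαY, hβY, h⟩
    exact ⟨α.exists_comp_eq_of_range_subset_image β (h.trans hβY).subset,
      β.exists_comp_eq_of_range_subset_image α (h.symm.trans hαY).subset⟩
end

section
/- Let X be a chain and let α, β ∈ O(X). Then α 𝓛 β in O(X) if and only if range(α) = range(β). -/
/-- A monotone map out of a chain lifts along a monotone map whose range contains its own. -/
theorem OrderHom.exists_lift_of_range_subset {X Y Z : Type*} [Preorder X] [LinearOrder Y]
    [PartialOrder Z] (f : X →o Z) (g : Y →o Z) (h : Set.range f ⊆ Set.range g) :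
    ∃ l : X →o Y, ∀ x, g (l x) = f x := by
  let s : X → Y := fun x => Set.rangeSplitting g ⟨f x, h ⟨x, rfl⟩⟩
  have hs : ∀ x, g (s x) = f x := fun x => Set.apply_rangeSplitting g _
  refine ⟨⟨s, fun x y hxy => ?_⟩, hs⟩
  rcases (f.monotone hxy).eq_or_lt with heq | hlt
  · exact le_of_eq (congrArg (Set.rangeSplitting g) (Subtype.ext heq))
  · rw [← hs x, ← hs y] at hlt
    exact (g.monotone.reflect_lt hlt).le

/-- Green's relation 𝓛 on the monoid `O(X)` of order-preserving self-maps of a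
chain `X` (product written left-to-right): `α 𝓛 β` iff `range α = range β`. -/
theorem green_L_on_OX
    {X : Type*} [LinearOrder X] (α β : X →o X) :
    ((∃ lam : X →o X, ∀ x, β (lam x) = α x) ∧
     (∃ mu : X →o X, ∀ x, α (mu x) = β x)) ↔
    Set.range ⇑α = Set.range ⇑β := by
  constructor
  · rintro ⟨⟨l, hl⟩, m, hm⟩
    apply Set.Subset.antisymm
    · rintro _ ⟨x, rfl⟩
      exact ⟨l x, hl x⟩
    · rintro _ ⟨x, rfl⟩
      exact ⟨m x, hm x⟩
  · intro h
    exact ⟨α.exists_lift_of_range_subset β h.subset, β.exists_lift_of_range_subset α h.superset⟩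
end

section
/- Let X be a chain, let Y be a nonempty subset of X, and let A be a subset of X. An order-preserving function θ : A → Y is completable in O(X,Y) if and only if for every order ideal I of A (a subset I of A such that x ∈ A, a ∈ I and x ≤ a imply x ∈ I), the following implication holds: if the set {x ∈ X : a < x < b for all a ∈ I and all b ∈ A \ I} is nonempty, then the set {y ∈ Y : θ(a) ≤ y ≤ θ(b) for all a ∈ I and all b ∈ A \ I} is nonempty. (When I = ∅ the first set means {x ∈ X : x < b for all b ∈ A} and when I = A it means {x ∈ X : a < x for all a ∈ A}, and analogously for the second set.) -/
/-- Completability criterion: an order-preserving function `θ : A → Y` (modeled as a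
map `θ : X → X` which is order-preserving on `A` with `θ(A) ⊆ Y`) is completable in
`O(X,Y)` (i.e. extends to an order-preserving self-map of `X` with range in `Y`)
iff for every order ideal `I` of `A`, if
`{x ∈ X : a < x < b for all a ∈ I, b ∈ A \ I}` is nonempty then
`{y ∈ Y : θ(a) ≤ y ≤ θ(b) for all a ∈ I, b ∈ A \ I}` is nonempty. -/
theorem completable_iff_ideal_condition
    {X : Type*} [LinearOrder X] (Y A : Set X) (hY : Y.Nonempty)
    (θ : X → X) (hθY : ∀ a ∈ A, θ a ∈ Y)
    (hθmono : ∀ a ∈ A, ∀ b ∈ A, a ≤ b → θ a ≤ θ b) :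
    (∃ γ : X →o X, (∀ x, γ x ∈ Y) ∧ ∀ a ∈ A, γ a = θ a) ↔
    (∀ I ⊆ A, (∀ x ∈ A, ∀ a ∈ I, x ≤ a → x ∈ I) →
      ({x : X | (∀ a ∈ I, a < x) ∧ ∀ b ∈ A \ I, x < b}.Nonempty →
       {y ∈ Y | (∀ a ∈ I, θ a ≤ y) ∧ ∀ b ∈ A \ I, y ≤ θ b}.Nonempty)) := by
  classical
  constructor
  · rintro ⟨γ, hγY, hγ⟩ I hI - ⟨x, hx₁, hx₂⟩
    refine ⟨γ x, hγY x, fun a ha => ?_, fun b hb => ?_⟩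
    · rw [← hγ a (hI ha)]
      exact γ.monotone (hx₁ a ha).le
    · rw [← hγ b hb.1]
      exact γ.monotone (hx₂ b hb).le
  · intro h
    -- The value chosen off `A` depends only on the cut of `A` determined by the point.
    have key : ∀ I : Set X, ∃ y, ∀ x ∉ A, {a ∈ A | a < x} = I →
        y ∈ Y ∧ (∀ a ∈ A, a < x → θ a ≤ y) ∧ ∀ b ∈ A, x < b → y ≤ θ b := by
      intro I
      by_cases hx : ∃ x ∉ A, {a ∈ A | a < x} = I
      · obtain ⟨x, hxA, rfl⟩ := hx
        obtain ⟨y, hyY, hy₁, hy₂⟩ := h {a ∈ A | a < x} (fun a ha => ha.1)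
          (fun z hz a ha hza => ⟨hz, hza.trans_lt ha.2⟩)
          ⟨x, fun a ha => ha.2, fun b hb => lt_of_le_of_ne
            (not_lt.1 fun hbx => hb.2 ⟨hb.1, hbx⟩) fun e => hxA (e ▸ hb.1)⟩
        refine ⟨y, fun x' _ hI => ⟨hyY, fun a ha hax => ?_, fun b hb hxb => ?_⟩⟩
        · exact hy₁ a (hI ▸ ⟨ha, hax⟩)
        · refine hy₂ b ⟨hb, fun hbI => ?_⟩
          rw [← hI] at hbI
          exact hxb.not_gt hbI.2
      · exact ⟨hY.some, fun x hxA hI => absurd ⟨x, hxA, hI⟩ hx⟩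
    choose g hg using key
    refine ⟨⟨fun x => if x ∈ A then θ x else g {a ∈ A | a < x}, fun x y hxy => ?_⟩,
      fun x => ?_, fun a ha => if_pos ha⟩
    · by_cases hx : x ∈ A <;> by_cases hy : y ∈ A <;> simp only [hx, hy, if_true, if_false]
      · exact hθmono x hx y hy hxy
      · exact (hg _ y hy rfl).2.1 x hx (lt_of_le_of_ne hxy fun e => hy (e ▸ hx))
      · exact (hg _ x hx rfl).2.2 y hy (lt_of_le_of_ne hxy fun e => hx (e ▸ hy))
      · by_cases hcut : ∃ a ∈ A, x < a ∧ a < y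
        · obtain ⟨a, ha, hxa, hay⟩ := hcut
          exact ((hg _ x hx rfl).2.2 a ha hxa).trans ((hg _ y hy rfl).2.1 a ha hay)
        · have e : {a ∈ A | a < x} = {a ∈ A | a < y} := by
            ext a
            refine ⟨fun ha => ⟨ha.1, ha.2.trans_le hxy⟩, fun ha => ⟨ha.1, ?_⟩⟩
            by_contra hax
            exact hcut ⟨a, ha.1, lt_of_le_of_ne (not_lt.1 hax) fun e => hx (e ▸ ha.1), ha.2⟩
          rw [e]
    · change (if x ∈ A then θ x else g {a ∈ A | a < x}) ∈ Y
      by_cases hx : x ∈ A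
      · simpa [hx] using hθY x hx
      · simpa [hx] using (hg _ x hx rfl).1
end

section
/- Let X be a chain, let Y be a nonempty subset of X, and let α, β ∈ O(X,Y). Then α 𝓡 β in O(X,Y) if and only if either α = β, or Ker(α) = Ker(β) and the canonical order-isomorphism θ : range(α) → range(β) is bicompletable in O(X,Y). Furthermore, if α and β are regular elements of O(X,Y), then α 𝓡 β in O(X,Y) if and only if Ker(α) = Ker(β). -/
/-- If `β` identifies every pair that `α` identifies and `α` is regular in `O(X,Y)`, then
`β = αγ` for some `γ ∈ O(X,Y)` (products written left-to-right). -/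
theorem OrderHom.exists_factor_of_regular {X : Type*} [LinearOrder X] {Y : Set X}
    {α β : X →o X} (hβ : ∀ x, β x ∈ Y) (hker : ∀ x y, α x = α y → β x = β y)
    (hreg : ∃ α' : X →o X, (∀ x, α' x ∈ Y) ∧ ∀ x, α (α' (α x)) = α x) :
    ∃ γ : X →o X, (∀ x, γ x ∈ Y) ∧ ∀ x, γ (α x) = β x := by
  obtain ⟨α', -, h⟩ := hreg
  exact ⟨β.comp α', fun x => hβ (α' x), fun x => hker _ _ (h x)⟩

/-- Maps that factor through each other have the same kernel. -/
theorem OrderHom.ker_eq_of_factor {X : Type*} [LinearOrder X] {α β γ ξ : X →o X}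
    (hγ : ∀ x, γ (β x) = α x) (hξ : ∀ x, ξ (α x) = β x) (x y : X) :
    α x = α y ↔ β x = β y :=
  ⟨fun h => by rw [← hξ x, ← hξ y, h], fun h => by rw [← hγ x, ← hγ y, h]⟩

/-- Green's relation 𝓡 on `O(X,Y)`: `α 𝓡 β` iff `α = β`, or `Ker α = Ker β` and the
canonical order-isomorphism `θ : range α → range β` (determined by `θ(α x) = β x`) is
bicompletable in `O(X,Y)`; completability of `θ` (resp. `θ⁻¹`) is expressed by the
existence of `γ ∈ O(X,Y)` with `γ(α x) = β x` for all `x` (resp. `ξ ∈ O(X,Y)` with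
`ξ(β x) = α x` for all `x`). Furthermore, if `α` and `β` are regular in `O(X,Y)`,
then `α 𝓡 β` iff `Ker α = Ker β`. Products are written left-to-right. -/
theorem green_R_on_OXY
    {X : Type*} [LinearOrder X] (Y : Set X) (hY : Y.Nonempty)
    (α β : X →o X) (hα : ∀ x, α x ∈ Y) (hβ : ∀ x, β x ∈ Y) :
    ((α = β ∨
        ((∃ γ : X →o X, (∀ x, γ x ∈ Y) ∧ ∀ x, γ (β x) = α x) ∧
         (∃ ξ : X →o X, (∀ x, ξ x ∈ Y) ∧ ∀ x, ξ (α x) = β x))) ↔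
      (α = β ∨
        ((∀ x y, α x = α y ↔ β x = β y) ∧
         (∃ γ : X →o X, (∀ x, γ x ∈ Y) ∧ ∀ x, γ (α x) = β x) ∧
         (∃ ξ : X →o X, (∀ x, ξ x ∈ Y) ∧ ∀ x, ξ (β x) = α x))))
    ∧
    ((∃ α' : X →o X, (∀ x, α' x ∈ Y) ∧ ∀ x, α (α' (α x)) = α x) →
     (∃ β' : X →o X, (∀ x, β' x ∈ Y) ∧ ∀ x, β (β' (β x)) = β x) →
      ((α = β ∨
          ((∃ γ : X →o X, (∀ x, γ x ∈ Y) ∧ ∀ x, γ (β x) = α x) ∧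
           (∃ ξ : X →o X, (∀ x, ξ x ∈ Y) ∧ ∀ x, ξ (α x) = β x))) ↔
        (∀ x y, α x = α y ↔ β x = β y))) := by
  refine ⟨or_congr_right ⟨?_, fun h => h.2.symm⟩, fun rα rβ => ⟨?_, fun hker => Or.inr ?_⟩⟩
  · rintro ⟨⟨γ, hγY, hγ⟩, ⟨ξ, hξY, hξ⟩⟩
    exact ⟨OrderHom.ker_eq_of_factor hγ hξ, ⟨ξ, hξY, hξ⟩, ⟨γ, hγY, hγ⟩⟩
  · rintro (rfl | ⟨⟨γ, -, hγ⟩, ⟨ξ, -, hξ⟩⟩)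
    · exact fun _ _ => Iff.rfl
    · exact OrderHom.ker_eq_of_factor hγ hξ
  · exact ⟨OrderHom.exists_factor_of_regular hα (fun x y => (hker x y).2) rβ,
      OrderHom.exists_factor_of_regular hβ (fun x y => (hker x y).1) rα⟩
end

section
/- Let X be a chain, let Y be a nonempty subset of X, and let α, β be regular elements of O(X,Y). Then α 𝓗 β in O(X,Y) if and only if range(α) = range(β) and Ker(α) = Ker(β). -/
theorem OrderHom.exists_left_factor_of_range_subset {X : Type*} [LinearOrder X] {Y : Set X}
    {α β : X →o X}
    (hβreg : ∃ β' : X →o X, (∀ x, β' x ∈ Y) ∧ ∀ x, β (β' (β x)) = β x)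
    (h : Set.range α ⊆ Set.range β) :
    ∃ lam : X →o X, (∀ x, lam x ∈ Y) ∧ ∀ x, β (lam x) = α x := by
  obtain ⟨β', hβ'Y, hβ'⟩ := hβreg
  refine ⟨β'.comp α, fun x => hβ'Y _, fun x => ?_⟩
  obtain ⟨z, hz⟩ := h ⟨x, rfl⟩
  simp only [OrderHom.comp_coe, Function.comp_apply, ← hz, hβ']

theorem OrderHom.exists_right_factor_of_ker_le {X : Type*} [LinearOrder X] {Y : Set X}
    {α β : X →o X} (hα : ∀ x, α x ∈ Y)
    (hβreg : ∃ β' : X →o X, (∀ x, β' x ∈ Y) ∧ ∀ x, β (β' (β x)) = β x)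
    (h : ∀ x y, β x = β y → α x = α y) :
    ∃ γ : X →o X, (∀ x, γ x ∈ Y) ∧ ∀ x, γ (β x) = α x := by
  obtain ⟨β', -, hβ'⟩ := hβreg
  exact ⟨α.comp β', fun x => hα _, fun x => h _ _ (hβ' x)⟩

/-- Green's relation 𝓗 on `O(X,Y)` for regular elements: if `α` and `β` are regular
in `O(X,Y)`, then `α 𝓗 β` (i.e. `α 𝓛 β` and `α 𝓡 β`) iff `range α = range β` and
`Ker α = Ker β`. Products are written left-to-right. -/
theorem green_H_regular_on_OXY
    {X : Type*} [LinearOrder X] (Y : Set X) (hY : Y.Nonempty)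
    (α β : X →o X) (hα : ∀ x, α x ∈ Y) (hβ : ∀ x, β x ∈ Y)
    (hαreg : ∃ α' : X →o X, (∀ x, α' x ∈ Y) ∧ ∀ x, α (α' (α x)) = α x)
    (hβreg : ∃ β' : X →o X, (∀ x, β' x ∈ Y) ∧ ∀ x, β (β' (β x)) = β x) :
    ((α = β ∨
        ((∃ lam : X →o X, (∀ x, lam x ∈ Y) ∧ ∀ x, β (lam x) = α x) ∧
         (∃ mu : X →o X, (∀ x, mu x ∈ Y) ∧ ∀ x, α (mu x) = β x))) ∧
     (α = β ∨
        ((∃ γ : X →o X, (∀ x, γ x ∈ Y) ∧ ∀ x, γ (β x) = α x) ∧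
         (∃ ξ : X →o X, (∀ x, ξ x ∈ Y) ∧ ∀ x, ξ (α x) = β x)))) ↔
    (Set.range ⇑α = Set.range ⇑β ∧ ∀ x y, α x = α y ↔ β x = β y) := by
  constructor
  · rintro ⟨rfl | ⟨⟨lam, -, hlam⟩, mu, -, hmu⟩, hR⟩
    · exact ⟨rfl, fun _ _ => Iff.rfl⟩
    · refine ⟨Set.Subset.antisymm ?_ ?_, fun x y => ?_⟩
      · rintro _ ⟨x, rfl⟩
        exact ⟨lam x, hlam x⟩
      · rintro _ ⟨x, rfl⟩
        exact ⟨mu x, hmu x⟩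
      · rcases hR with rfl | ⟨⟨γ, -, hγ⟩, ξ, -, hξ⟩
        · exact Iff.rfl
        · exact ⟨fun h => by rw [← hξ, h, hξ], fun h => by rw [← hγ, h, hγ]⟩
  · rintro ⟨hrange, hker⟩
    exact ⟨Or.inr ⟨OrderHom.exists_left_factor_of_range_subset hβreg hrange.subset,
        OrderHom.exists_left_factor_of_range_subset hαreg hrange.symm.subset⟩,
      Or.inr ⟨OrderHom.exists_right_factor_of_ker_le hα hβreg fun x y => (hker x y).2,
        OrderHom.exists_right_factor_of_ker_le hβ hαreg fun x y => (hker x y).1⟩⟩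
end

section
/- Let X be a chain, let Y be a nonempty subset of X, and let α, β be regular elements of O(X,Y). Then α 𝓓 β in O(X,Y) if and only if range(α) and range(β) are order-isomorphic (as subchains of X). -/
/-- Monotone maps that factor through each other on the left have order-isomorphic ranges. -/
theorem OrderHom.nonempty_range_orderIso_of_comp_eq {A B C : Type*} [Preorder A] [Preorder B]
    [Preorder C] {f : A →o B} {h : A →o C} {g : C →o B} {k : B →o C}
    (hg : ∀ x, g (h x) = f x) (hk : ∀ x, k (f x) = h x) :
    Nonempty (Set.range f ≃o Set.range h) := by
  refine ⟨Equiv.toOrderIso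
    { toFun := fun y => ⟨k y, ?_⟩
      invFun := fun z => ⟨g z, ?_⟩
      left_inv := ?_
      right_inv := ?_ } ?_ ?_⟩
  · obtain ⟨_, x, rfl⟩ := y
    exact ⟨x, (hk x).symm⟩
  · obtain ⟨_, x, rfl⟩ := z
    exact ⟨x, (hg x).symm⟩
  · rintro ⟨_, x, rfl⟩
    simp [hk, hg]
  · rintro ⟨_, x, rfl⟩
    simp [hk, hg]
  · exact fun _ _ h => k.monotone h
  · exact fun _ _ h => g.monotone h

/-- Maps that factor through each other on the right have the same range. -/
theorem Set.range_eq_range_of_comp_eq {A B C : Type*} {f : A → C} {h : B → C} {l : A → B}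
    {m : B → A} (hl : ∀ x, h (l x) = f x) (hm : ∀ x, f (m x) = h x) :
    Set.range f = Set.range h := by
  apply Set.Subset.antisymm
  · rintro _ ⟨x, rfl⟩
    exact ⟨l x, hl x⟩
  · rintro _ ⟨x, rfl⟩
    exact ⟨m x, hm x⟩

/-- A monotone map followed by an order isomorphism from its range onto another range. -/
def OrderHom.transportRange {A B C D : Type*} [Preorder A] [Preorder B] [Preorder D] (f : A →o B)
    {h : C → D} (φ : Set.range f ≃o Set.range h) : A →o D where
  toFun x := φ ⟨f x, x, rfl⟩
  monotone' _ _ hxy := φ.monotone (f.monotone hxy)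

theorem OrderHom.transportRange_mem {A B C D : Type*} [Preorder A] [Preorder B] [Preorder D]
    (f : A →o B) {h : C → D} (φ : Set.range f ≃o Set.range h) {Y : Set D} (hY : ∀ x, h x ∈ Y)
    (x : A) : f.transportRange φ x ∈ Y :=
  Set.range_subset_iff.2 hY (φ ⟨f x, x, rfl⟩).2

theorem OrderHom.transportRange_congr {A B C D : Type*} [Preorder A] [Preorder B] [Preorder D]
    (f : A →o B) {h : C → D} (φ : Set.range f ≃o Set.range h) {x : A} {y : Set.range f}
    (hxy : f x = y) : f.transportRange φ x = φ y :=
  congrArg (fun z => (φ z : D)) (Subtype.ext hxy)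

/-- If `f f' f = f` then `f f'` fixes the range of `f` pointwise. -/
theorem Set.apply_apply_coe_range {A B : Type*} {f : A → B} {f' : B → A}
    (hf : ∀ x, f (f' (f x)) = f x) (y : Set.range f) : f (f' y) = y := by
  obtain ⟨_, x, rfl⟩ := y
  exact hf x

/-- Green's relation 𝓓 on `O(X,Y)` for regular elements: if `α` and `β` are regular
in `O(X,Y)`, then `α 𝓓 β` (i.e. there is `γ ∈ O(X,Y)` with `α 𝓡 γ` and `γ 𝓛 β`) iff
`range α` and `range β` are order-isomorphic subchains of `X`.
Products are written left-to-right. -/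
theorem green_D_regular_on_OXY
    {X : Type*} [LinearOrder X] (Y : Set X) (hY : Y.Nonempty)
    (α β : X →o X) (hα : ∀ x, α x ∈ Y) (hβ : ∀ x, β x ∈ Y)
    (hαreg : ∃ α' : X →o X, (∀ x, α' x ∈ Y) ∧ ∀ x, α (α' (α x)) = α x)
    (hβreg : ∃ β' : X →o X, (∀ x, β' x ∈ Y) ∧ ∀ x, β (β' (β x)) = β x) :
    (∃ γ : X →o X, (∀ x, γ x ∈ Y) ∧
      (α = γ ∨
        ((∃ g : X →o X, (∀ x, g x ∈ Y) ∧ ∀ x, g (γ x) = α x) ∧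
         (∃ ξ : X →o X, (∀ x, ξ x ∈ Y) ∧ ∀ x, ξ (α x) = γ x))) ∧
      (γ = β ∨
        ((∃ lam : X →o X, (∀ x, lam x ∈ Y) ∧ ∀ x, β (lam x) = γ x) ∧
         (∃ mu : X →o X, (∀ x, mu x ∈ Y) ∧ ∀ x, γ (mu x) = β x)))) ↔
    Nonempty ((Set.range ⇑α) ≃o (Set.range ⇑β)) := by
  obtain ⟨α', hα', hαα⟩ := hαreg
  obtain ⟨β', hβ', hββ⟩ := hβreg
  constructor
  · rintro ⟨γ, -, hR, hL⟩
    have hrange : Set.range γ = Set.range β := by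
      rcases hL with rfl | ⟨⟨lam, -, hlam⟩, mu, -, hmu⟩
      · rfl
      · exact Set.range_eq_range_of_comp_eq hlam hmu
    rw [← hrange]
    rcases hR with rfl | ⟨⟨g, -, hg⟩, ξ, -, hξ⟩
    · exact ⟨OrderIso.refl _⟩
    · exact OrderHom.nonempty_range_orderIso_of_comp_eq hg hξ
  · rintro ⟨φ⟩
    have hfixα := Set.apply_apply_coe_range hαα
    have hfixβ := Set.apply_apply_coe_range hββ
    refine ⟨α.transportRange φ, α.transportRange_mem φ hβ,
      Or.inr ⟨⟨(β.transportRange φ.symm).comp β', fun _ => β.transportRange_mem _ hα _, fun x => ?_⟩,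
        (α.transportRange φ).comp α', fun _ => α.transportRange_mem _ hβ _, fun x => ?_⟩,
      Or.inr ⟨⟨β'.comp (α.transportRange φ), fun _ => hβ' _, fun x => ?_⟩,
        α'.comp (β.transportRange φ.symm), fun _ => hα' _, fun x => ?_⟩⟩
    · exact (β.transportRange_congr φ.symm (hfixβ (φ ⟨α x, x, rfl⟩))).trans (by simp)
    · exact α.transportRange_congr φ (y := ⟨α x, x, rfl⟩) (hαα x)
    · exact hfixβ (φ ⟨α x, x, rfl⟩)
    · exact (α.transportRange_congr φ (hfixα (φ.symm ⟨β x, x, rfl⟩))).trans (by simp)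
end

section
/- Let X be a chain and let α, β ∈ O(X). Then α 𝓙 β in O(X) if and only if there exist injective order-preserving functions θ : range(α) → range(β) and τ : range(β) → range(α) whose inverses θ⁻¹ : θ(range(α)) → range(α) and τ⁻¹ : τ(range(β)) → range(β) are completable in O(X). -/
/-- `α` factors through `β` in `O(X)` iff there is an injective order-preserving function
`range α → range β` whose inverse is completable in `O(X)`. -/
theorem OrderHom.exists_factor_iff_exists_range_embedding
    {X : Type*} [LinearOrder X] (α β : X →o X) :
    (∃ lam gam : X →o X, ∀ x, gam (β (lam x)) = α x) ↔
      ∃ θ : X → X,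
        (∀ a ∈ Set.range ⇑α, θ a ∈ Set.range ⇑β) ∧
        (∀ a ∈ Set.range ⇑α, ∀ b ∈ Set.range ⇑α, a ≤ b → θ a ≤ θ b) ∧
        Set.InjOn θ (Set.range ⇑α) ∧
        (∃ γ : X →o X, ∀ a ∈ Set.range ⇑α, γ (θ a) = a) := by
  constructor
  · rintro ⟨lam, gam, h⟩
    have hs : ∀ a, ∃ b, a ∈ Set.range ⇑α → b ∈ Set.range ⇑β ∧ gam b = a := by
      intro a
      by_cases ha : a ∈ Set.range ⇑α
      · obtain ⟨x, rfl⟩ := ha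
        exact ⟨β (lam x), fun _ => ⟨⟨lam x, rfl⟩, h x⟩⟩
      · exact ⟨a, fun h' => absurd h' ha⟩
    choose θ hθ using hs
    refine ⟨θ, fun a ha => (hθ a ha).1, ?_, ?_, gam, fun a ha => (hθ a ha).2⟩
    · intro a ha b hb hab
      by_contra! hlt
      have hba : b ≤ a := by
        simpa only [(hθ a ha).2, (hθ b hb).2] using gam.monotone hlt.le
      exact hlt.ne (congrArg θ (le_antisymm hba hab))
    · intro a ha b hb hab
      rw [← (hθ a ha).2, ← (hθ b hb).2, hab]
  · rintro ⟨θ, hmem, hmono, -, γ, hγ⟩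
    have hs : ∀ b, ∃ y, b ∈ Set.range ⇑β → β y = b := by
      intro b
      by_cases hb : b ∈ Set.range ⇑β
      · obtain ⟨y, hy⟩ := hb
        exact ⟨y, fun _ => hy⟩
      · exact ⟨b, fun h' => absurd h' hb⟩
    choose σ hσ using hs
    have hβ : ∀ x, β (σ (θ (α x))) = θ (α x) := fun x => hσ _ (hmem _ ⟨x, rfl⟩)
    refine ⟨⟨fun x => σ (θ (α x)), fun x y hxy => ?_⟩, γ, fun x => ?_⟩
    · have hle := hmono _ ⟨x, rfl⟩ _ ⟨y, rfl⟩ (α.monotone hxy)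
      by_contra! hlt
      have hge := β.monotone hlt.le
      simp only [hβ] at hge
      exact hlt.ne (congrArg σ (le_antisymm hge hle))
    · exact (congrArg γ (hβ x)).trans (hγ _ ⟨x, rfl⟩)

/-- Green's relation 𝓙 on the monoid `O(X)`: `α 𝓙 β` (i.e. `α = λβγ` and `β = δαξ`
for some `λ, γ, δ, ξ ∈ O(X)`, products written left-to-right) iff there exist
injective order-preserving functions `θ : range α → range β` and
`τ : range β → range α` whose inverses (defined on `θ(range α)`, resp. `τ(range β)`)
are completable in `O(X)`. -/
theorem green_J_on_OX
    {X : Type*} [LinearOrder X] (α β : X →o X) :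
    ((∃ lam gam : X →o X, ∀ x, gam (β (lam x)) = α x) ∧
     (∃ del xi : X →o X, ∀ x, xi (α (del x)) = β x)) ↔
    ((∃ θ : X → X,
        (∀ a ∈ Set.range ⇑α, θ a ∈ Set.range ⇑β) ∧
        (∀ a ∈ Set.range ⇑α, ∀ b ∈ Set.range ⇑α, a ≤ b → θ a ≤ θ b) ∧
        Set.InjOn θ (Set.range ⇑α) ∧
        (∃ γ : X →o X, ∀ a ∈ Set.range ⇑α, γ (θ a) = a)) ∧
     (∃ τ : X → X,
        (∀ b ∈ Set.range ⇑β, τ b ∈ Set.range ⇑α) ∧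
        (∀ a ∈ Set.range ⇑β, ∀ b ∈ Set.range ⇑β, a ≤ b → τ a ≤ τ b) ∧
        Set.InjOn τ (Set.range ⇑β) ∧
        (∃ ξ : X →o X, ∀ b ∈ Set.range ⇑β, ξ (τ b) = b))) :=
  and_congr (OrderHom.exists_factor_iff_exists_range_embedding α β)
    (OrderHom.exists_factor_iff_exists_range_embedding β α)
end

section
/- Let X be a chain, let Y be a nonempty subset of X, and let α, β ∈ O(X,Y). Then α 𝓙 β in O(X,Y) if and only if one of the following holds: (1) α 𝓛 β in O(X,Y); (2) α 𝓡 β in O(X,Y); (3) there exist injective order-preserving functions θ : range(α) → β(Y) and τ : range(β) → α(Y) whose inverses θ⁻¹ : θ(range(α)) → range(α) and τ⁻¹ : τ(range(β)) → range(β) are completable in O(X,Y). -/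
/-- Factors in `O(X,Y)¹`: either the adjoined identity (the factor is absent,
modeled by the identity function) or an element of `O(X,Y)`. -/
def OXYone {X : Type*} [LinearOrder X] (Y : Set X) (f : X → X) : Prop :=
  f = id ∨ (Monotone f ∧ ∀ x, f x ∈ Y)

namespace OXYone

variable {X : Type*} [LinearOrder X] {Y : Set X}

theorem monotone {f : X → X} (hf : OXYone Y f) : Monotone f := by
  rcases hf with rfl | hf
  exacts [monotone_id, hf.1]

/-- A triple product `fgf` lies in `O(X,Y)` as soon as one of `f`, `g` does. -/
theorem sandwich_mem {f g : X → X} (hf : OXYone Y f) (hg : OXYone Y g)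
    (h : ¬ (f = id ∧ g = id)) (x : X) : f (g (f x)) ∈ Y := by
  rcases hf with rfl | hf
  · rcases hg with rfl | hg
    · exact absurd ⟨rfl, rfl⟩ h
    · exact hg.2 x
  · exact hf.2 _

end OXYone

/-- `α = λβγ` with `λ, γ ∈ O(X,Y)` iff `range α` embeds into `β(Y)` by a map whose inverse is
completable in `O(X,Y)`. -/
theorem exists_two_sided_factor_iff {X : Type*} [LinearOrder X] (Y : Set X) (α β : X →o X) :
    (∃ lam gam : X →o X, (∀ x, lam x ∈ Y) ∧ (∀ x, gam x ∈ Y) ∧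
        ∀ x, gam (β (lam x)) = α x) ↔
      ∃ θ : X → X,
        (∀ a ∈ Set.range ⇑α, θ a ∈ ⇑β '' Y) ∧
        (∀ a ∈ Set.range ⇑α, ∀ b ∈ Set.range ⇑α, a ≤ b → θ a ≤ θ b) ∧
        Set.InjOn θ (Set.range ⇑α) ∧
        (∃ γ : X →o X, (∀ x, γ x ∈ Y) ∧ ∀ a ∈ Set.range ⇑α, γ (θ a) = a) := by
  constructor
  · rintro ⟨lam, gam, hl, hg, h⟩
    have hex : ∀ a : X, ∃ x, a ∈ Set.range ⇑α → α x = a := by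
      intro a
      by_cases ha : a ∈ Set.range ⇑α
      · obtain ⟨x, hx⟩ := ha
        exact ⟨x, fun _ => hx⟩
      · exact ⟨a, fun h => absurd h ha⟩
    choose s hs using hex
    have inv : ∀ a ∈ Set.range ⇑α, gam (β (lam (s a))) = a := fun a ha => by
      rw [h, hs a ha]
    refine ⟨fun a => β (lam (s a)), fun a _ => ⟨_, hl _, rfl⟩, ?_, ?_, gam, hg, inv⟩
    · intro a ha b hb hab
      by_contra! hlt
      have hba := gam.monotone hlt.le
      rw [inv a ha, inv b hb] at hba
      obtain rfl := le_antisymm hab hba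
      exact lt_irrefl _ hlt
    · exact Set.LeftInvOn.injOn inv
  · rintro ⟨θ, hθ, hmono, hinj, γ, hγ, inv⟩
    have hchoice : ∃ lam : X →o X, ∀ x, lam x ∈ Y ∧ β (lam x) = θ (α x) := by
      choose t htY ht using fun a : Set.range ⇑α => hθ a a.2
      refine ⟨⟨fun x => t ⟨α x, x, rfl⟩, ?_⟩, fun x => ⟨htY _, ht _⟩⟩
      intro x x' hxx
      rcases (α.monotone hxx).eq_or_lt with heq | hlt
      · exact (congrArg t (Subtype.ext heq)).le
      · by_contra! hcon
        have hle := β.monotone hcon.le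
        rw [ht, ht] at hle
        have hθle := hmono _ ⟨x, rfl⟩ _ ⟨x', rfl⟩ hlt.le
        exact hlt.ne (hinj ⟨x, rfl⟩ ⟨x', rfl⟩ (le_antisymm hθle hle))
    obtain ⟨lam, hlam⟩ := hchoice
    refine ⟨lam, γ, fun x => (hlam x).1, hγ, fun x => ?_⟩
    rw [(hlam x).2, inv _ ⟨x, rfl⟩]

/-- If `α = λβγ` and `β = δαξ`, where `λ, δ` are not both absent and `γ, ξ` are not both absent,
then `α ∈ O(X,Y) β O(X,Y)`. -/
theorem exists_two_sided_factor {X : Type*} [LinearOrder X] {Y : Set X} {α β : X → X}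
    {lam gam del xi : X → X}
    (hlam : OXYone Y lam) (hgam : OXYone Y gam) (hdel : OXYone Y del) (hxi : OXYone Y xi)
    (hα : ∀ x, gam (β (lam x)) = α x) (hβ : ∀ x, xi (α (del x)) = β x)
    (hleft : ¬ (lam = id ∧ del = id)) (hright : ¬ (gam = id ∧ xi = id)) :
    ∃ l g : X →o X, (∀ x, l x ∈ Y) ∧ (∀ x, g x ∈ Y) ∧ ∀ x, g (β (l x)) = α x := by
  refine ⟨⟨fun x => lam (del (lam x)), hlam.monotone.comp (hdel.monotone.comp hlam.monotone)⟩,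
    ⟨fun x => gam (xi (gam x)), hgam.monotone.comp (hxi.monotone.comp hgam.monotone)⟩,
    hlam.sandwich_mem hdel hleft, hgam.sandwich_mem hxi hright, fun x => ?_⟩
  change gam (xi (gam (β (lam (del (lam x)))))) = α x
  rw [hα, hβ, hα]

/-- Green's relation 𝓙 on `O(X,Y)`: `α 𝓙 β` iff (1) `α 𝓛 β`, or (2) `α 𝓡 β`, or
(3) there exist injective order-preserving functions `θ : range α → β(Y)` and
`τ : range β → α(Y)` whose inverses are completable in `O(X,Y)`.
Products are written left-to-right. -/
theorem green_J_on_OXY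
    {X : Type*} [LinearOrder X] (Y : Set X) (hY : Y.Nonempty)
    (α β : X →o X) (hα : ∀ x, α x ∈ Y) (hβ : ∀ x, β x ∈ Y) :
    ((∃ lam gam : X → X, OXYone Y lam ∧ OXYone Y gam ∧
        ∀ x, gam (β (lam x)) = α x) ∧
     (∃ del xi : X → X, OXYone Y del ∧ OXYone Y xi ∧
        ∀ x, xi (α (del x)) = β x)) ↔
    ((α = β ∨
        ((∃ lam : X →o X, (∀ x, lam x ∈ Y) ∧ ∀ x, β (lam x) = α x) ∧
         (∃ mu : X →o X, (∀ x, mu x ∈ Y) ∧ ∀ x, α (mu x) = β x))) ∨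
     (α = β ∨
        ((∃ γ : X →o X, (∀ x, γ x ∈ Y) ∧ ∀ x, γ (β x) = α x) ∧
         (∃ ξ : X →o X, (∀ x, ξ x ∈ Y) ∧ ∀ x, ξ (α x) = β x))) ∨
     ((∃ θ : X → X,
          (∀ a ∈ Set.range ⇑α, θ a ∈ ⇑β '' Y) ∧
          (∀ a ∈ Set.range ⇑α, ∀ b ∈ Set.range ⇑α, a ≤ b → θ a ≤ θ b) ∧
          Set.InjOn θ (Set.range ⇑α) ∧
          (∃ γ : X →o X, (∀ x, γ x ∈ Y) ∧ ∀ a ∈ Set.range ⇑α, γ (θ a) = a)) ∧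
      (∃ τ : X → X,
          (∀ b ∈ Set.range ⇑β, τ b ∈ ⇑α '' Y) ∧
          (∀ a ∈ Set.range ⇑β, ∀ b ∈ Set.range ⇑β, a ≤ b → τ a ≤ τ b) ∧
          Set.InjOn τ (Set.range ⇑β) ∧
          (∃ ξ : X →o X, (∀ x, ξ x ∈ Y) ∧ ∀ b ∈ Set.range ⇑β, ξ (τ b) = b)))) := by
  rw [← exists_two_sided_factor_iff Y α β, ← exists_two_sided_factor_iff Y β α]
  constructor
  · rintro ⟨⟨lam, gam, hlam, hgam, h₁⟩, del, xi, hdel, hxi, h₂⟩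
    by_cases hleft : lam = id ∧ del = id
    · obtain ⟨rfl, rfl⟩ := hleft
      refine Or.inr (Or.inl ?_)
      rcases hgam with rfl | hgam
      · exact Or.inl (OrderHom.ext _ _ (funext fun x => (h₁ x).symm))
      rcases hxi with rfl | hxi
      · exact Or.inl (OrderHom.ext _ _ (funext h₂))
      exact Or.inr ⟨⟨⟨gam, hgam.1⟩, hgam.2, h₁⟩, ⟨xi, hxi.1⟩, hxi.2, h₂⟩
    by_cases hright : gam = id ∧ xi = id
    · obtain ⟨rfl, rfl⟩ := hright
      refine Or.inl ?_
      rcases hlam with rfl | hlam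
      · exact Or.inl (OrderHom.ext _ _ (funext fun x => (h₁ x).symm))
      rcases hdel with rfl | hdel
      · exact Or.inl (OrderHom.ext _ _ (funext h₂))
      exact Or.inr ⟨⟨⟨lam, hlam.1⟩, hlam.2, h₁⟩, ⟨del, hdel.1⟩, hdel.2, h₂⟩
    exact Or.inr (Or.inr
      ⟨exists_two_sided_factor hlam hgam hdel hxi h₁ h₂ hleft hright,
        exists_two_sided_factor hdel hxi hlam hgam h₂ h₁
          (fun h => hleft h.symm) (fun h => hright h.symm)⟩)
  · have one : OXYone Y id := Or.inl rfl
    have mem : ∀ f : X →o X, (∀ x, f x ∈ Y) → OXYone Y f := fun f hf => Or.inr ⟨f.monotone, hf⟩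
    rintro ((rfl | ⟨⟨l, hl, h₁⟩, m, hm, h₂⟩) | (rfl | ⟨⟨g, hg, h₁⟩, k, hk, h₂⟩) |
      ⟨⟨l, g, hl, hg, h₁⟩, m, k, hm, hk, h₂⟩)
    · exact ⟨⟨id, id, one, one, fun _ => rfl⟩, id, id, one, one, fun _ => rfl⟩
    · exact ⟨⟨l, id, mem l hl, one, h₁⟩, m, id, mem m hm, one, h₂⟩
    · exact ⟨⟨id, id, one, one, fun _ => rfl⟩, id, id, one, one, fun _ => rfl⟩
    · exact ⟨⟨id, g, one, mem g hg, h₁⟩, id, k, one, mem k hk, h₂⟩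
    · exact ⟨⟨l, g, mem l hl, mem g hg, h₁⟩, m, k, mem m hm, mem k hk, h₂⟩
end

section
/- Let X and X' be chains, let Y and Y' be nonempty subsets of X and X' respectively, and let Θ : O(X,Y) → O(X',Y') be a semigroup isomorphism (a bijection with Θ(αβ) = Θ(α)Θ(β) for all α, β). Then for every x ∈ Y there exists a unique x' ∈ Y' such that Θ maps the constant map of X with value x to the constant map of X' with value x'; moreover, the induced map θ : Y → Y' defined by this correspondence is a bijection. -/
/-- The semigroup `O(X,Y)` of order-preserving self-maps of the chain `X` with
range contained in `Y`. -/
def OXY (X : Type*) [LinearOrder X] (Y : Set X) : Type _ :=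
  {f : X →o X // ∀ x, f x ∈ Y}

/-- The product of `O(X,Y)`, written left-to-right: `(a * b)(x) = b(a(x))`. -/
def OXY.mul {X : Type*} [LinearOrder X] {Y : Set X} (a b : OXY X Y) : OXY X Y :=
  ⟨b.1.comp a.1, fun x => b.2 (a.1 x)⟩

/-- The constant map of `X` with value `y ∈ Y`, as an element of `O(X,Y)`. -/
def OXY.const {X : Type*} [LinearOrder X] (Y : Set X) (y : X) (hy : y ∈ Y) :
    OXY X Y :=
  ⟨⟨fun _ => y, monotone_const⟩, fun _ => hy⟩

namespace OXY

variable {X X' : Type*} [LinearOrder X] [LinearOrder X'] {Y : Set X} {Y' : Set X'}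

theorem const_injective {y z : X} (hy : y ∈ Y) (hz : z ∈ Y)
    (h : const Y y hy = const Y z hz) : y = z :=
  congrArg (fun f : OXY X Y => f.1 y) h

/-- The constant maps are exactly the right zeros of `O(X,Y)`. -/
theorem exists_eq_const_iff (hY : Y.Nonempty) (c : OXY X Y) :
    (∃ y : Y, c = const Y y.1 y.2) ↔ ∀ a, mul a c = c := by
  constructor
  · rintro ⟨y, rfl⟩ a
    rfl
  · intro h
    obtain ⟨y, hy⟩ := hY
    exact ⟨⟨c.1 y, c.2 y⟩, (h (const Y y hy)).symm⟩

/-- A bijective homomorphism preserves and reflects right zeros. -/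
theorem forall_mul_map_eq_iff {Θ : OXY X Y → OXY X' Y'} (hbij : Function.Bijective Θ)
    (hhom : ∀ a b, Θ (mul a b) = mul (Θ a) (Θ b)) (c : OXY X Y) :
    (∀ a', mul a' (Θ c) = Θ c) ↔ ∀ a, mul a c = c := by
  rw [hbij.surjective.forall]
  refine forall_congr' fun a => ?_
  rw [← hhom, hbij.injective.eq_iff]

end OXY

/-- A semigroup isomorphism `Θ : O(X,Y) → O(X',Y')` maps each constant map with
value `x ∈ Y` to a constant map with a unique value `x' ∈ Y'`, and the induced map
`θ : Y → Y'` is a bijection. -/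
theorem isomorphism_induces_bijection_on_constants
    {X X' : Type*} [LinearOrder X] [LinearOrder X']
    (Y : Set X) (Y' : Set X') (hY : Y.Nonempty) (hY' : Y'.Nonempty)
    (Θ : OXY X Y → OXY X' Y') (hbij : Function.Bijective Θ)
    (hhom : ∀ a b, Θ (OXY.mul a b) = OXY.mul (Θ a) (Θ b)) :
    (∀ y : Y, ∃! y' : Y', Θ (OXY.const Y y.1 y.2) = OXY.const Y' y'.1 y'.2) ∧
    (∃ θ : Y → Y', Function.Bijective θ ∧
       ∀ y : Y, Θ (OXY.const Y y.1 y.2) = OXY.const Y' (θ y).1 (θ y).2) := by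
  have hconst (c : OXY X Y) : (∃ y' : Y', Θ c = OXY.const Y' y'.1 y'.2) ↔
      ∃ y : Y, c = OXY.const Y y.1 y.2 := by
    rw [OXY.exists_eq_const_iff hY', OXY.exists_eq_const_iff hY,
      OXY.forall_mul_map_eq_iff hbij hhom]
  have hex (y : Y) : ∃ y' : Y', Θ (OXY.const Y y.1 y.2) = OXY.const Y' y'.1 y'.2 :=
    (hconst _).2 ⟨y, rfl⟩
  refine ⟨fun y => ?_, ?_⟩
  · obtain ⟨y', hy'⟩ := hex y
    exact ⟨y', hy', fun z' hz' =>
      Subtype.ext (OXY.const_injective z'.2 y'.2 (hz'.symm.trans hy'))⟩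
  · choose θ hθ using hex
    refine ⟨θ, ⟨fun y z h => ?_, fun y' => ?_⟩, hθ⟩
    · refine Subtype.ext (OXY.const_injective y.2 z.2 (hbij.injective ?_))
      rw [hθ, hθ, h]
    · obtain ⟨c, hc⟩ := hbij.surjective (OXY.const Y' y'.1 y'.2)
      obtain ⟨y, rfl⟩ := (hconst c).1 ⟨y', hc⟩
      exact ⟨y, Subtype.ext (OXY.const_injective _ _ ((hθ y).symm.trans hc))⟩
end

section
/- Let X and X' be chains, let Y and Y' be nonempty subsets of X and X' respectively, let Θ : O(X,Y) → O(X',Y') be a semigroup isomorphism, and let θ : Y → Y' be the induced bijection determined by the property that Θ maps the constant map with value x to the constant map with value θ(x), for all x ∈ Y. Then θ is either an order-isomorphism or an order-anti-isomorphism from Y onto Y'. -/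
namespace OXY

variable {X : Type*} [LinearOrder X] {Y : Set X}

lemma const_mul (y : Y) (a : OXY X Y) :
    OXY.mul (OXY.const Y y.1 y.2) a = OXY.const Y (a.1 y.1) (a.2 y.1) := rfl

lemma const_injective_s11 (hY : Y.Nonempty) :
    Function.Injective fun y : Y => OXY.const Y y.1 y.2 := by
  intro a b h
  obtain ⟨x, -⟩ := hY
  exact Subtype.ext (congrArg (fun f : OXY X Y => f.1 x) h)

/-- Given `x < y` in `X` and `u ≤ v` in `Y`, some element of `O(X,Y)` sends `x` to `u`
and `y` to `v`. -/
lemma exists_apply_eq_apply_eq {x y : X} (hxy : x < y) {u v : Y} (huv : u ≤ v) :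
    ∃ a : OXY X Y, a.1 x = u ∧ a.1 y = v := by
  refine ⟨⟨⟨fun t => if t ≤ x then u.1 else v.1, fun s t hst => ?_⟩, fun t => ?_⟩, ?_, ?_⟩
  · have huv' : u.1 ≤ v.1 := huv
    dsimp only
    split_ifs with hs ht
    · exact le_rfl
    · exact huv'
    · exact absurd (hst.trans ‹t ≤ x›) hs
    · exact le_rfl
  · change (if t ≤ x then u.1 else v.1) ∈ Y
    split_ifs
    exacts [u.2, v.2]
  · exact if_pos le_rfl
  · exact if_neg hxy.not_ge

end OXY

/-- If `Θ : O(X,Y) → O(X',Y')` is a semigroup isomorphism and `θ : Y → Y'` is the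
induced map determined by `Θ (const x) = const (θ x)` for all `x ∈ Y`, then `θ` is
either an order-isomorphism or an order-anti-isomorphism from `Y` onto `Y'`. -/
theorem induced_map_is_order_iso_or_anti_iso
    {X X' : Type*} [LinearOrder X] [LinearOrder X']
    (Y : Set X) (Y' : Set X') (hY : Y.Nonempty) (hY' : Y'.Nonempty)
    (Θ : OXY X Y → OXY X' Y') (hbij : Function.Bijective Θ)
    (hhom : ∀ a b, Θ (OXY.mul a b) = OXY.mul (Θ a) (Θ b))
    (θ : Y → Y')
    (hθ : ∀ y : Y, Θ (OXY.const Y y.1 y.2) = OXY.const Y' (θ y).1 (θ y).2) :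
    Function.Bijective θ ∧
      ((∀ a b : Y, a ≤ b ↔ θ a ≤ θ b) ∨ (∀ a b : Y, a ≤ b ↔ θ b ≤ θ a)) := by
  have happ : ∀ (a : OXY X Y) (y : Y), (Θ a).1 (θ y).1 = (θ ⟨a.1 y.1, a.2 y.1⟩).1 := by
    intro a y
    have h := hhom (OXY.const Y y.1 y.2) a
    rw [OXY.const_mul, hθ y, OXY.const_mul, hθ ⟨a.1 y.1, a.2 y.1⟩] at h
    exact (congrArg Subtype.val (OXY.const_injective_s11 hY'
      (a₁ := θ ⟨a.1 y.1, a.2 y.1⟩) (a₂ := ⟨(Θ a).1 (θ y).1, (Θ a).2 (θ y).1⟩) h)).symm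
  have hinj : Function.Injective θ := by
    intro a b h
    refine OXY.const_injective_s11 hY (hbij.1 ?_)
    change Θ (OXY.const Y a.1 a.2) = Θ (OXY.const Y b.1 b.2)
    rw [hθ a, hθ b, h]
  have hsurj : Function.Surjective θ := by
    intro y'
    obtain ⟨a, ha⟩ := hbij.2 (OXY.const Y' y'.1 y'.2)
    obtain ⟨y, hy⟩ := hY
    refine ⟨⟨a.1 y, a.2 y⟩, Subtype.ext ?_⟩
    rw [← happ a ⟨y, hy⟩, ha]
    rfl
  refine ⟨⟨hinj, hsurj⟩, ?_⟩
  by_cases h : ∃ x y : Y, x < y ∧ θ x < θ y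
  · left
    obtain ⟨x, y, hxy, hθxy⟩ := h
    have hmono : Monotone θ := by
      intro u v huv
      obtain ⟨a, hu, hv⟩ := OXY.exists_apply_eq_apply_eq (x := x.1) (y := y.1) hxy huv
      have hle : (Θ a).1 (θ x).1 ≤ (Θ a).1 (θ y).1 := (Θ a).1.monotone hθxy.le
      rw [happ, happ] at hle
      simp only [hu, hv] at hle
      exact hle
    exact fun a b => (hmono.strictMono_of_injective hinj).le_iff_le.symm
  · right
    push Not at h
    have hanti : StrictAnti θ := fun a b hab =>
      (h a b hab).lt_of_ne (hinj.ne hab.ne')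
    exact fun a b => hanti.le_iff_ge.symm
end

section
/- Let X and X' be chains. Then there exists a semigroup isomorphism between the monoids O(X) and O(X') if and only if X and X' are either order-isomorphic or order-anti-isomorphic. -/
/-- Conjugation by a bijection which, in both directions, turns monotone self-maps into monotone
self-maps is an isomorphism between the monoids of order-preserving self-maps. -/
theorem exists_iso_of_conj_monotone {X X' : Type*} [LinearOrder X] [LinearOrder X'] (e : X ≃ X')
    (h : ∀ f : X → X, Monotone f → Monotone (e ∘ f ∘ e.symm))
    (h' : ∀ g : X' → X', Monotone g → Monotone (e.symm ∘ g ∘ e)) :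
    ∃ Θ : (X →o X) → (X' →o X'), Function.Bijective Θ ∧
      ∀ f g : X →o X, Θ (g.comp f) = (Θ g).comp (Θ f) := by
  refine ⟨fun f => ⟨e ∘ f ∘ e.symm, h f f.monotone⟩, ⟨fun f g hfg => ?_, fun g => ?_⟩,
    fun f g => ?_⟩
  · ext x
    simpa using DFunLike.congr_fun hfg (e x)
  · refine ⟨⟨e.symm ∘ g ∘ e, h' g g.monotone⟩, ?_⟩
    ext x
    simp
  · ext x
    simp

/-- An isomorphism between the monoids of order-preserving self-maps of two nonempty chains is
conjugation by a bijection of the chains. -/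
theorem exists_equiv_conj_of_iso {X X' : Type*} [LinearOrder X] [LinearOrder X']
    [Nonempty X] [Nonempty X'] (Θ : (X →o X) → (X' →o X')) (hΘ : Function.Bijective Θ)
    (hmul : ∀ f g : X →o X, Θ (g.comp f) = (Θ g).comp (Θ f)) :
    ∃ φ : X → X', Function.Bijective φ ∧ ∀ (f : X →o X) (a : X), Θ f (φ a) = φ (f a) := by
  have hconst : ∀ a : X, ∃ y : X', Θ (OrderHom.const X a) = OrderHom.const X' y := by
    intro a
    obtain ⟨y₀⟩ := ‹Nonempty X'›
    obtain ⟨k, hk⟩ := hΘ.2 (OrderHom.const X' y₀)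
    refine ⟨Θ (OrderHom.const X a) y₀, ?_⟩
    have hak := hmul k (OrderHom.const X a)
    rw [hk, OrderHom.const_comp] at hak
    rw [hak]
    ext x
    simp
  choose φ hφ using hconst
  refine ⟨φ, ⟨fun a b hab => ?_, fun y => ?_⟩, fun f a => ?_⟩
  · have hc : OrderHom.const X a = OrderHom.const X b := hΘ.1 (by rw [hφ, hφ, hab])
    simpa using DFunLike.congr_fun hc a
  · obtain ⟨x₀⟩ := ‹Nonempty X›
    obtain ⟨k, hk⟩ := hΘ.2 (OrderHom.const X' y)
    have hkc : k.comp (OrderHom.const X x₀) = k :=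
      hΘ.1 (by rw [hmul, hk, OrderHom.const_comp])
    rw [OrderHom.comp_const] at hkc
    refine ⟨k x₀, ?_⟩
    have hy : OrderHom.const X' (φ (k x₀)) = OrderHom.const X' y := by
      rw [← hφ, hkc, hk]
    exact DFunLike.congr_fun hy y
  · have hfa := hmul (OrderHom.const X a) f
    rw [OrderHom.comp_const, hφ, hφ] at hfa
    exact (DFunLike.congr_fun hfa (φ a)).symm

/-- In a chain, any `c ≤ d` are the images of given `a < b` under some order-preserving map. -/
theorem exists_orderHom_of_lt_of_le {X : Type*} [LinearOrder X] {a b c d : X}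
    (hab : a < b) (hcd : c ≤ d) : ∃ f : X →o X, f a = c ∧ f b = d := by
  have hmono : Monotone fun x => if x ≤ a then c else d := by
    intro x y hxy
    dsimp only
    split_ifs with hx hy hy
    · exact le_rfl
    · exact hcd
    · exact absurd (hxy.trans hy) hx
    · exact le_rfl
  exact ⟨⟨_, hmono⟩, if_pos le_rfl, if_neg hab.not_ge⟩

/-- For (nonempty) chains `X` and `X'`, the monoids `O(X)` and `O(X')` (with
product written left-to-right, so `fg = g ∘ f`) are isomorphic as semigroups iff
`X` and `X'` are order-isomorphic or order-anti-isomorphic. -/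
theorem iso_OX_iff
    {X X' : Type*} [LinearOrder X] [LinearOrder X'] [Nonempty X] [Nonempty X'] :
    (∃ Θ : (X →o X) → (X' →o X'), Function.Bijective Θ ∧
        ∀ f g : X →o X, Θ (g.comp f) = (Θ g).comp (Θ f)) ↔
    ((∃ φ : X → X', Function.Bijective φ ∧ ∀ a b, a ≤ b ↔ φ a ≤ φ b) ∨
     (∃ φ : X → X', Function.Bijective φ ∧ ∀ a b, a ≤ b ↔ φ b ≤ φ a)) := by
  constructor
  · rintro ⟨Θ, hΘ, hmul⟩
    obtain ⟨φ, hφ, hconj⟩ := exists_equiv_conj_of_iso Θ hΘ hmul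
    by_cases hanti : StrictAnti φ
    · exact Or.inr ⟨φ, hφ, fun a b => hanti.le_iff_ge.symm⟩
    · simp only [StrictAnti, not_forall, not_lt] at hanti
      obtain ⟨a, b, hab, hle⟩ := hanti
      have hmono : StrictMono φ := by
        intro c d hcd
        obtain ⟨f, rfl, rfl⟩ := exists_orderHom_of_lt_of_le hab hcd.le
        refine lt_of_le_of_ne ?_ (hφ.1.ne hcd.ne)
        rw [← hconj, ← hconj]
        exact (Θ f).monotone hle
      exact Or.inl ⟨φ, hφ, fun a b => hmono.le_iff_le.symm⟩
  · rintro (⟨φ, hφ, hle⟩ | ⟨φ, hφ, hle⟩)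
    all_goals
      obtain ⟨e, rfl⟩ : ∃ e : X ≃ X', ⇑e = φ := ⟨Equiv.ofBijective φ hφ, rfl⟩
      refine exists_iso_of_conj_monotone e (fun f hf x y hxy => ?_) (fun g hg x y hxy => ?_)
      · exact (hle _ _).1 (hf ((hle _ _).2 (by simpa using hxy)))
      · exact (hle _ _).2 (by simpa using hg ((hle _ _).1 hxy))
end

section
/- Let n ∈ ℕ and let Y be a nonempty subset of the chain {1 < 2 < ⋯ < n}. Then the set of regular elements of O_n(Y) is exactly {α ∈ O_n(Y) : range(α) = α(Y)}. Moreover, O_n(Y) is a regular semigroup (every element is regular) if and only if Y = {1,2,…,n}, or |Y| = 1, or Y = {1, n}. -/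
section OrderPreservingMaps

variable {X : Type*} [LinearOrder X] {Y : Set X}

/-- A regular element of the semigroup of order-preserving maps into `Y` has `range α = α(Y)`. -/
theorem range_eq_image_of_regular {α β : X →o X} (hβ : ∀ x, β x ∈ Y)
    (h : ∀ x, α (β (α x)) = α x) : Set.range ⇑α = ⇑α '' Y := by
  refine Set.Subset.antisymm ?_ (Set.image_subset_range _ _)
  rintro _ ⟨x, rfl⟩
  exact ⟨β (α x), hβ _, h x⟩

/-- On a finite chain, `range α = α(Y)` yields an order-preserving inner inverse of `α` with values
in `Y`, sending `x` to the largest `y ∈ Y` with `α y ≤ x` (or to the least element of `Y`). -/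
theorem exists_inner_inverse_of_range_eq_image [Finite X] (hY : Y.Nonempty) {α : X →o X}
    (h : Set.range ⇑α = ⇑α '' Y) :
    ∃ β : X →o X, (∀ x, β x ∈ Y) ∧ ∀ x, α (β (α x)) = α x := by
  obtain ⟨m, hmY, hm⟩ := Set.exists_min_image Y id Y.toFinite hY
  have hmax (x : X) : ∃ z, (z ∈ Y ∧ (α z ≤ x ∨ z = m)) ∧
      ∀ y, (y ∈ Y ∧ (α y ≤ x ∨ y = m)) → y ≤ z :=
    Set.exists_max_image {y | y ∈ Y ∧ (α y ≤ x ∨ y = m)} id (Set.toFinite _)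
      ⟨m, hmY, Or.inr rfl⟩
  choose β hβ hβmax using hmax
  refine ⟨⟨β, fun x x' hx => hβmax x' _ ⟨(hβ x).1, (hβ x).2.imp_left (·.trans hx)⟩⟩,
    fun x => (hβ x).1, fun x => ?_⟩
  obtain ⟨y, hy, hyx⟩ : α x ∈ ⇑α '' Y := h ▸ Set.mem_range_self x
  refine le_antisymm ?_ ?_
  · rcases (hβ (α x)).2 with hle | heq
    · exact hle
    · exact (α.monotone (heq.trans_le (hm y hy))).trans_eq hyx
  · exact hyx.symm.trans_le (α.monotone (hβmax _ y ⟨hy, Or.inl hyx.le⟩))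

/-- The order-preserving map sending everything below `d` to `a`, the point `d` to `c`, and
everything above `d` to `e`. -/
def threeStep (d a c e : X) (hac : a ≤ c) (hce : c ≤ e) : X →o X where
  toFun x := if x < d then a else if x = d then c else e
  monotone' x y hxy := by
    have := hac.trans hce
    grind

/-- If every order-preserving map into `Y` satisfies `range α = α(Y)`, then a point `d ∉ Y`
severely restricts the chains `a ≤ c ≤ e` in `Y`. -/
theorem eq_or_eq_of_range_eq_image
    (h : ∀ α : X →o X, (∀ x, α x ∈ Y) → Set.range ⇑α = ⇑α '' Y) {d a c e : X} (hd : d ∉ Y)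
    (ha : a ∈ Y) (hc : c ∈ Y) (he : e ∈ Y) (hac : a ≤ c) (hce : c ≤ e) :
    ∃ y ∈ Y, y < d ∧ c = a ∨ d < y ∧ c = e := by
  have hr := h (threeStep d a c e hac hce) fun x => by
    change (if x < d then a else if x = d then c else e) ∈ Y
    split_ifs <;> assumption
  obtain ⟨y, hy, hyd⟩ := hr ▸ Set.mem_range_self d
  change (if y < d then a else if y = d then c else e) =
    if d < d then a else if d = d then c else e at hyd
  refine ⟨y, hy, ?_⟩
  grind

/-- If `Y` is everything, a singleton, or the pair of extreme elements, then every
order-preserving map into `Y` satisfies `range α = α(Y)`. -/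
theorem range_eq_image_of_extreme
    (h : Y = Set.univ ∨ Y.ncard = 1 ∨ ∃ b t : X, IsBot b ∧ IsTop t ∧ Y = {b, t})
    {α : X →o X} (hα : ∀ x, α x ∈ Y) : Set.range ⇑α = ⇑α '' Y := by
  refine Set.Subset.antisymm ?_ (Set.image_subset_range _ _)
  rintro _ ⟨x, rfl⟩
  rcases h with rfl | h | ⟨b, t, hb, ht, rfl⟩
  · exact ⟨x, trivial, rfl⟩
  · obtain ⟨c, rfl⟩ := Set.ncard_eq_one.mp h
    exact ⟨c, rfl, (hα c).trans (hα x).symm⟩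
  · rcases hα x with hx | hx
    · exact ⟨b, Or.inl rfl, le_antisymm (α.monotone (hb x)) (hx.trans_le (hb _))⟩
    · exact ⟨t, Or.inr rfl, le_antisymm ((ht _).trans_eq hx.symm) (α.monotone (ht x))⟩

/-- If every order-preserving map into the nonempty subset `Y` of a finite chain satisfies
`range α = α(Y)`, then `Y` is everything, a singleton, or the pair of extreme elements. -/
theorem extreme_of_range_eq_image [Finite X] (hY : Y.Nonempty)
    (h : ∀ α : X →o X, (∀ x, α x ∈ Y) → Set.range ⇑α = ⇑α '' Y) :
    Y = Set.univ ∨ Y.ncard = 1 ∨ ∃ b t : X, IsBot b ∧ IsTop t ∧ Y = {b, t} := by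
  obtain ⟨b, hbY, hb⟩ := Set.exists_min_image Y id Y.toFinite hY
  obtain ⟨t, htY, ht⟩ := Set.exists_max_image Y id Y.toFinite hY
  simp only [id] at hb ht
  by_cases huniv : Y = Set.univ
  · exact Or.inl huniv
  obtain ⟨d, hd⟩ := (Set.ne_univ_iff_exists_notMem Y).mp huniv
  rcases (hb t htY).eq_or_lt with hbt | hbt
  · refine Or.inr (Or.inl (Set.ncard_eq_one.mpr ⟨b, ?_⟩))
    ext y
    exact ⟨fun hy => le_antisymm (hbt ▸ ht y hy) (hb y hy), fun hy => hy ▸ hbY⟩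
  refine Or.inr (Or.inr ⟨b, t, fun x => ?_, fun x => ?_, ?_⟩)
  · by_contra! hx
    obtain ⟨y, hy, hyx⟩ := eq_or_eq_of_range_eq_image h (fun hxY => (hb x hxY).not_gt hx)
      hbY hbY htY le_rfl hbt.le
    have := hb y hy
    grind
  · by_contra! hx
    obtain ⟨y, hy, hyx⟩ := eq_or_eq_of_range_eq_image h (fun hxY => (ht x hxY).not_gt hx)
      hbY htY htY hbt.le le_rfl
    have := ht y hy
    grind
  · refine Set.Subset.antisymm (fun c hc => ?_) ?_
    · obtain ⟨y, -, hyc⟩ := eq_or_eq_of_range_eq_image h hd hbY hc htY (hb c hc) (ht c hc)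
      exact hyc.imp And.right And.right
    · rintro _ (rfl | rfl) <;> assumption

end OrderPreservingMaps

/-- For the chain `{1 < 2 < ⋯ < n}` (modeled by `Fin n`) and a nonempty `Y`:
the regular elements of `O_n(Y)` are exactly those `α` with `range α = α(Y)`;
moreover `O_n(Y)` is a regular semigroup iff `Y = {1,…,n}`, or `|Y| = 1`, or
`Y = {1, n}` (the set consisting of the bottom and the top element).
Products are written left-to-right. -/
theorem regular_elements_and_regularity_of_OnY
    (n : ℕ) (Y : Set (Fin n)) (hY : Y.Nonempty) :
    (∀ α : Fin n →o Fin n, (∀ x, α x ∈ Y) →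
        ((∃ β : Fin n →o Fin n, (∀ x, β x ∈ Y) ∧ ∀ x, α (β (α x)) = α x) ↔
          Set.range ⇑α = ⇑α '' Y)) ∧
    ((∀ α : Fin n →o Fin n, (∀ x, α x ∈ Y) →
        ∃ β : Fin n →o Fin n, (∀ x, β x ∈ Y) ∧ ∀ x, α (β (α x)) = α x) ↔
      (Y = Set.univ ∨ Y.ncard = 1 ∨
        ∃ b t : Fin n, IsBot b ∧ IsTop t ∧ Y = {b, t})) := by
  have hreg (α : Fin n →o Fin n) :
      (∃ β : Fin n →o Fin n, (∀ x, β x ∈ Y) ∧ ∀ x, α (β (α x)) = α x) ↔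
        Set.range ⇑α = ⇑α '' Y :=
    ⟨fun ⟨_, hβ, h⟩ => range_eq_image_of_regular hβ h, exists_inner_inverse_of_range_eq_image hY⟩
  refine ⟨fun α _ => hreg α, fun h => ?_, fun h α hα => ?_⟩
  · exact extreme_of_range_eq_image hY fun α hα => (hreg α).mp (h α hα)
  · exact (hreg α).mpr (range_eq_image_of_extreme h hα)
end

section
/- Let n ∈ ℕ, let Y be a nonempty subset of the chain {1 < 2 < ⋯ < n}, and let α, β ∈ O_n(Y). Then: (1) α 𝓛 β in O_n(Y) if and only if either α = β, or α and β are both regular in O_n(Y) and range(α) = range(β); (2) α 𝓡 β in O_n(Y) if and only if Ker(α) = Ker(β); (3) α 𝓓 β in O_n(Y) if and only if either α and β are both regular in O_n(Y) and |range(α)| = |range(β)|, or α and β are both non-regular in O_n(Y) and Ker(α) = Ker(β). -/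
/-- Membership in `O_n(Y)`: an order-preserving self-map of `Fin n` with range in `Y`. -/
def InOnY (n : ℕ) (Y : Set (Fin n)) (α : Fin n →o Fin n) : Prop :=
  ∀ x, α x ∈ Y

/-- Regularity in `O_n(Y)` (products written left-to-right). -/
def RegOnY (n : ℕ) (Y : Set (Fin n)) (α : Fin n →o Fin n) : Prop :=
  ∃ β : Fin n →o Fin n, InOnY n Y β ∧ ∀ x, α (β (α x)) = α x

/-- Green's relation 𝓛 on `O_n(Y)`. -/
def LrelOnY (n : ℕ) (Y : Set (Fin n)) (α β : Fin n →o Fin n) : Prop :=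
  α = β ∨
    ((∃ lam : Fin n →o Fin n, InOnY n Y lam ∧ ∀ x, β (lam x) = α x) ∧
     (∃ mu : Fin n →o Fin n, InOnY n Y mu ∧ ∀ x, α (mu x) = β x))

/-- Green's relation 𝓡 on `O_n(Y)`. -/
def RrelOnY (n : ℕ) (Y : Set (Fin n)) (α β : Fin n →o Fin n) : Prop :=
  α = β ∨
    ((∃ γ : Fin n →o Fin n, InOnY n Y γ ∧ ∀ x, γ (β x) = α x) ∧
     (∃ ξ : Fin n →o Fin n, InOnY n Y ξ ∧ ∀ x, ξ (α x) = β x))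

/-- A nonempty subset of a finite chain is the image of an order-preserving retraction. -/
lemma exists_orderHom_retraction {n : ℕ} {S : Set (Fin n)} (hS : S.Nonempty) :
    ∃ r : Fin n →o Fin n, (∀ x, r x ∈ S) ∧ ∀ x ∈ S, r x = x := by
  classical
  obtain ⟨m, hm, hmin⟩ := S.toFinite.exists_minimal hS
  have hmin' : ∀ s ∈ S, m ≤ s := fun s hs => (le_total m s).elim id (hmin hs)
  let T : Fin n → Finset (Fin n) := fun x => S.toFinset.filter (· ≤ max x m)
  have hT : ∀ x, (T x).Nonempty := fun x => ⟨m, by simp [T, hm]⟩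
  have hmem : ∀ x, (T x).max' (hT x) ∈ S ∧ (T x).max' (hT x) ≤ max x m := fun x => by
    simpa only [T, Finset.mem_filter, Set.mem_toFinset] using (T x).max'_mem (hT x)
  refine ⟨⟨fun x => (T x).max' (hT x), fun x y hxy => ?_⟩, fun x => (hmem x).1, fun x hx => ?_⟩
  · refine Finset.max'_subset (hT x) fun z hz => ?_
    simp only [T, Finset.mem_filter] at hz ⊢
    exact ⟨hz.1, hz.2.trans (max_le_max_right m hxy)⟩
  · refine le_antisymm ((hmem x).2.trans_eq (max_eq_left (hmin' x hx))) ?_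
    exact Finset.le_max' _ _ (by simp [T, hx])

/-- A monotone function on a nonempty subset of a finite chain extends to the whole chain
without enlarging its image. -/
lemma MonotoneOn.exists_orderHom_extension {n : ℕ} {S : Set (Fin n)} (hS : S.Nonempty)
    {f : Fin n → Fin n} (hf : MonotoneOn f S) :
    ∃ g : Fin n →o Fin n, (∀ x, g x ∈ f '' S) ∧ ∀ x ∈ S, g x = f x := by
  obtain ⟨r, hr, hr'⟩ := exists_orderHom_retraction hS
  exact ⟨⟨fun x => f (r x), fun x y hxy => hf (hr x) (hr y) (r.monotone hxy)⟩,
    fun x => ⟨r x, hr x, rfl⟩, fun x hx => congrArg f (hr' x hx)⟩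

/-- An order-preserving map factors through any other one with a smaller kernel. -/
lemma InOnY.exists_factor {n : ℕ} {Y : Set (Fin n)} (hY : Y.Nonempty) {α β : Fin n →o Fin n}
    (hα : InOnY n Y α) (h : ∀ x y, β x = β y → α x = α y) :
    ∃ γ : Fin n →o Fin n, InOnY n Y γ ∧ ∀ x, γ (β x) = α x := by
  obtain ⟨y₀, -⟩ := hY
  have : Nonempty (Fin n) := ⟨y₀⟩
  have hinv : ∀ x, α (Function.invFun β (β x)) = α x := fun x =>
    h _ _ (Function.invFun_eq ⟨x, rfl⟩)
  have hmono : MonotoneOn (fun v => α (Function.invFun β v)) (Set.range β) := by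
    rintro _ ⟨x, rfl⟩ _ ⟨y, rfl⟩ hxy
    simp only [hinv]
    rcases le_total x y with hle | hle
    · exact α.monotone hle
    · exact (h x y (le_antisymm hxy (β.monotone hle))).le
  obtain ⟨γ, hγ, hγ'⟩ := hmono.exists_orderHom_extension (Set.range_nonempty β)
  refine ⟨γ, fun x => ?_, fun x => (hγ' _ (Set.mem_range_self x)).trans (hinv x)⟩
  obtain ⟨v, -, hv⟩ := hγ x
  exact hv ▸ hα _

/-- An element of `O_n(Y)` is regular iff each of its values is attained on `Y`. -/
lemma regOnY_iff {n : ℕ} {Y : Set (Fin n)} (hY : Y.Nonempty) {α : Fin n →o Fin n} :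
    RegOnY n Y α ↔ ∀ x, ∃ y ∈ Y, α y = α x := by
  refine ⟨fun ⟨b, hb, hb'⟩ x => ⟨b (α x), hb _, hb' x⟩, fun h => ?_⟩
  obtain ⟨y₀, -⟩ := hY
  choose p hpY hp using h
  have : Nonempty (Fin n) := ⟨y₀⟩
  have hinv : ∀ x, α (p (Function.invFun α (α x))) = α x := fun x =>
    (hp _).trans (Function.invFun_eq ⟨x, rfl⟩)
  have hmono : MonotoneOn (fun v => p (Function.invFun α v)) (Set.range α) := by
    rintro _ ⟨x, rfl⟩ _ ⟨y, rfl⟩ hxy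
    by_contra hlt
    have hle := α.monotone (not_le.mp hlt).le
    rw [hinv, hinv] at hle
    exact hlt (by simp only [le_antisymm hxy hle, le_refl])
  obtain ⟨b, hb, hb'⟩ := hmono.exists_orderHom_extension (Set.range_nonempty α)
  refine ⟨b, fun x => ?_, fun x => by rw [hb' _ (Set.mem_range_self x), hinv]⟩
  obtain ⟨v, -, hv⟩ := hb x
  exact hv ▸ hpY _

lemma regOnY_congr_ker {n : ℕ} {Y : Set (Fin n)} (hY : Y.Nonempty) {α β : Fin n →o Fin n}
    (h : ∀ x y, α x = α y ↔ β x = β y) : RegOnY n Y α ↔ RegOnY n Y β := by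
  simp only [regOnY_iff hY, h]

lemma lrelOnY_iff {n : ℕ} {Y : Set (Fin n)} (hY : Y.Nonempty) {α β : Fin n →o Fin n} :
    LrelOnY n Y α β ↔
      (α = β ∨ (RegOnY n Y α ∧ RegOnY n Y β ∧ Set.range ⇑α = Set.range ⇑β)) := by
  refine or_congr_right ⟨?_, ?_⟩
  · rintro ⟨⟨l, hl, hl'⟩, ⟨m, hm, hm'⟩⟩
    refine ⟨(regOnY_iff hY).2 fun x => ⟨m (l x), hm _, by rw [hm', hl']⟩,
      (regOnY_iff hY).2 fun x => ⟨l (m x), hl _, by rw [hl', hm']⟩, ?_⟩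
    apply Set.Subset.antisymm <;> rintro _ ⟨x, rfl⟩
    exacts [⟨l x, hl' x⟩, ⟨m x, hm' x⟩]
  · rintro ⟨⟨a, ha, ha'⟩, ⟨b, hb, hb'⟩, hr⟩
    refine ⟨⟨b.comp α, fun x => hb _, fun x => ?_⟩, ⟨a.comp β, fun x => ha _, fun x => ?_⟩⟩
    · obtain ⟨z, hz⟩ : α x ∈ Set.range β := hr ▸ ⟨x, rfl⟩
      simp only [OrderHom.comp_coe, Function.comp_apply, ← hz, hb']
    · obtain ⟨z, hz⟩ : β x ∈ Set.range α := hr ▸ ⟨x, rfl⟩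
      simp only [OrderHom.comp_coe, Function.comp_apply, ← hz, ha']

lemma rrelOnY_iff {n : ℕ} {Y : Set (Fin n)} (hY : Y.Nonempty) {α β : Fin n →o Fin n}
    (hα : InOnY n Y α) (hβ : InOnY n Y β) :
    RrelOnY n Y α β ↔ ∀ x y, α x = α y ↔ β x = β y := by
  constructor
  · rintro (rfl | ⟨⟨g, -, hg⟩, ⟨k, -, hk⟩⟩) x y
    · rfl
    · exact ⟨fun h => by rw [← hk, ← hk, h], fun h => by rw [← hg, ← hg, h]⟩
  · exact fun h => Or.inr ⟨hα.exists_factor hY fun x y => (h x y).2,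
      hβ.exists_factor hY fun x y => (h x y).1⟩

lemma ncard_range_congr_ker {ι κ κ' : Type*} {f : ι → κ} {g : ι → κ'}
    (h : ∀ x y, f x = f y ↔ g x = g y) : (Set.range f).ncard = (Set.range g).ncard := by
  have hker : Setoid.ker f = Setoid.ker g := Setoid.ext h
  rw [← Nat.card_coe_set_eq, ← Nat.card_coe_set_eq]
  exact Nat.card_congr ((Setoid.quotientKerEquivRange f).symm.trans
    ((Quotient.congrRight h).trans (Setoid.quotientKerEquivRange g)))

/-- Order-preserving maps with equally large ranges: one has a translate with its own kernel and
the range of the other. -/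
lemma exists_orderHom_ker_range {n : ℕ} {α β : Fin n →o Fin n}
    (h : (Set.range ⇑α).ncard = (Set.range ⇑β).ncard) :
    ∃ γ : Fin n →o Fin n, (∀ x y, α x = α y ↔ γ x = γ y) ∧
      Set.range ⇑γ = Set.range ⇑β := by
  classical
  have hcard : Fintype.card (Set.range ⇑β) = Fintype.card (Set.range ⇑α) := by
    rw [← Nat.card_eq_fintype_card, ← Nat.card_eq_fintype_card, Nat.card_coe_set_eq,
      Nat.card_coe_set_eq, h]
  let e : Set.range ⇑α ≃o Set.range ⇑β :=
    (Fintype.orderIsoFinOfCardEq _ rfl).symm.trans (Fintype.orderIsoFinOfCardEq _ hcard)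
  refine ⟨⟨fun x => e ⟨α x, Set.mem_range_self x⟩, fun x y hxy => e.monotone (α.monotone hxy)⟩,
    fun x y => ?_, ?_⟩
  · change _ ↔ (e ⟨α x, Set.mem_range_self x⟩ : Fin n) = e ⟨α y, Set.mem_range_self y⟩
    rw [Subtype.coe_inj, e.injective.eq_iff, Subtype.mk.injEq]
  · apply Set.Subset.antisymm
    · rintro _ ⟨x, rfl⟩
      exact (e ⟨α x, Set.mem_range_self x⟩).2
    · intro v hv
      obtain ⟨⟨_, x, rfl⟩, hx⟩ := e.surjective ⟨v, hv⟩
      exact ⟨x, congrArg Subtype.val hx⟩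

/-- Green's relations 𝓛, 𝓡 and 𝓓 on `O_n(Y)`:
(1) `α 𝓛 β` iff `α = β`, or both are regular and `range α = range β`;
(2) `α 𝓡 β` iff `Ker α = Ker β`;
(3) `α 𝓓 β` iff both are regular and `|range α| = |range β|`, or both are
non-regular and `Ker α = Ker β`. -/
theorem green_relations_on_OnY
    (n : ℕ) (Y : Set (Fin n)) (hY : Y.Nonempty)
    (α β : Fin n →o Fin n) (hα : InOnY n Y α) (hβ : InOnY n Y β) :
    (LrelOnY n Y α β ↔
      (α = β ∨
        (RegOnY n Y α ∧ RegOnY n Y β ∧ Set.range ⇑α = Set.range ⇑β))) ∧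
    (RrelOnY n Y α β ↔ ∀ x y, α x = α y ↔ β x = β y) ∧
    ((∃ γ : Fin n →o Fin n, InOnY n Y γ ∧ RrelOnY n Y α γ ∧ LrelOnY n Y γ β) ↔
      ((RegOnY n Y α ∧ RegOnY n Y β ∧
          (Set.range ⇑α).ncard = (Set.range ⇑β).ncard) ∨
       (¬ RegOnY n Y α ∧ ¬ RegOnY n Y β ∧ ∀ x y, α x = α y ↔ β x = β y))) := by
  refine ⟨lrelOnY_iff hY, rrelOnY_iff hY hα hβ, ?_, ?_⟩
  · rintro ⟨γ, hγ, hR, hL⟩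
    rw [rrelOnY_iff hY hα hγ] at hR
    have hreg := regOnY_congr_ker hY hR
    have hcard := ncard_range_congr_ker hR
    rcases (lrelOnY_iff hY).1 hL with rfl | ⟨hγr, hβr, hr⟩
    · by_cases hαr : RegOnY n Y α
      · exact Or.inl ⟨hαr, hreg.1 hαr, hcard⟩
      · exact Or.inr ⟨hαr, mt hreg.2 hαr, hR⟩
    · exact Or.inl ⟨hreg.2 hγr, hβr, hr ▸ hcard⟩
  · rintro (⟨hαr, hβr, hcard⟩ | ⟨-, -, hker⟩)
    · obtain ⟨γ, hker, hr⟩ := exists_orderHom_ker_range hcard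
      have hγ : InOnY n Y γ := fun x => by
        obtain ⟨z, hz⟩ : γ x ∈ Set.range β := hr ▸ ⟨x, rfl⟩
        exact hz ▸ hβ z
      exact ⟨γ, hγ, (rrelOnY_iff hY hα hγ).2 hker,
        (lrelOnY_iff hY).2 (Or.inr ⟨(regOnY_congr_ker hY hker).1 hαr, hβr, hr⟩)⟩
    · exact ⟨β, hβ, (rrelOnY_iff hY hα hβ).2 hker, Or.inl rfl⟩
end

section
/- Let n ∈ ℕ, let Y be a subset of {1,…,n} with r = |Y| and 1 < r < n, and let α ∈ O_n(Y) with |range(α)| = r − 1. Then α = βγ for some β, γ ∈ O_n(Y) such that |range(β)| = r, |range(γ)| = r − 1, and γ is regular in O_n(Y). -/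
/-- A monotone map out of a finite linear order has a monotone generalized inverse. -/
theorem Monotone.exists_monotone_generalized_inverse {A B : Type*} [LinearOrder A] [OrderBot A]
    [Fintype A] [PartialOrder B] {f : A → B} (hf : Monotone f) :
    ∃ s : B → A, Monotone s ∧ ∀ a, f (s (f a)) = f a := by
  classical
  refine ⟨fun b => (Finset.univ.filter fun a => f a ≤ b).sup id, ?_, fun a => ?_⟩
  · intro b c hbc
    refine Finset.sup_mono fun a ha => ?_
    simp only [Finset.mem_filter, Finset.mem_univ, true_and] at ha ⊢
    exact ha.trans hbc
  · have ha : a ∈ Finset.univ.filter fun a' => f a' ≤ f a := by simp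
    apply le_antisymm
    · obtain ⟨c, hc, hsup⟩ := Finset.exists_mem_eq_sup _ ⟨a, ha⟩ (id : A → A)
      simp only [hsup]
      simpa using hc
    · exact hf (Finset.le_sup (f := id) ha)

/-- A non-injective monotone map between finite chains factors through a monotone surjection
onto a chain having one more element than its range. -/
theorem Monotone.exists_factor_through_fin_ncard_range_succ {n m : ℕ} {f : Fin n → Fin m}
    (hf : Monotone f) (hinj : ¬ Function.Injective f) {r : ℕ}
    (hr : (Set.range f).ncard + 1 = r) :
    ∃ (b : Fin n → Fin r) (g : Fin r → Fin m), Monotone b ∧ Monotone g ∧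
      Function.Surjective b ∧ ∀ x, g (b x) = f x := by
  classical
  obtain ⟨j, y, hjy, hlt⟩ : ∃ j y, f j = f y ∧ j < y := by
    simp only [Function.Injective, not_forall] at hinj
    obtain ⟨x, y, hxy, hne⟩ := hinj
    rcases lt_or_gt_of_ne hne with h | h
    exacts [⟨x, y, hxy, h⟩, ⟨y, x, hxy.symm, h⟩]
  -- Doubling the values of `f` makes room to split the fibre of `f j` just after `j`.
  let φ : Fin n → ℕ := fun x => 2 * (f x : ℕ) + if j < x then 1 else 0
  have hφ : Monotone φ := by
    intro x z hxz
    have h : (f x : ℕ) ≤ f z := hf hxz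
    simp only [φ]
    split_ifs with h₁ h₂
    · omega
    · exact absurd (h₁.trans_le hxz) h₂
    all_goals omega
  have hdiv : ∀ x, φ x / 2 = f x := by
    intro x
    simp only [φ]
    split_ifs <;> omega
  let T : Finset ℕ := Finset.univ.image φ
  have hmem : ∀ x, φ x ∈ T := fun x => Finset.mem_image_of_mem _ (Finset.mem_univ x)
  have hval : ∀ x, φ x ≠ φ y → φ x = 2 * (f x : ℕ) + if f j < f x then 1 else 0 := by
    intro x hx
    have hy : φ y = 2 * (f j : ℕ) + 1 := by simp [φ, hlt, hjy]
    by_cases h : j < x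
    · have hx' : φ x = 2 * (f x : ℕ) + 1 := by simp [φ, h]
      have hle : f j ≤ f x := hf h.le
      have hne : f j ≠ f x := fun he => hx (by rw [hx', hy, he])
      rw [hx', if_pos (lt_of_le_of_ne hle hne)]
    · have hle : f x ≤ f j := hf (not_lt.1 h)
      rw [if_neg hle.not_gt]
      simp [φ, h]
  have hcard : T.card = r := by
    have herase : (T.erase (φ y)).card = (Finset.univ.image f).card := by
      refine Finset.card_bij (fun t ht => ⟨t / 2, ?_⟩) ?_ ?_ ?_
      · obtain ⟨x, -, rfl⟩ := Finset.mem_image.1 (Finset.mem_of_mem_erase ht)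
        rw [hdiv]
        exact (f x).2
      · intro t ht
        obtain ⟨x, -, rfl⟩ := Finset.mem_image.1 (Finset.mem_of_mem_erase ht)
        exact Finset.mem_image.2 ⟨x, Finset.mem_univ x, Fin.ext (hdiv x).symm⟩
      · intro t ht s hs hts
        have hts' : t / 2 = s / 2 := congrArg Fin.val hts
        obtain ⟨x, -, rfl⟩ := Finset.mem_image.1 (Finset.mem_of_mem_erase ht)
        obtain ⟨z, -, rfl⟩ := Finset.mem_image.1 (Finset.mem_of_mem_erase hs)
        rw [hdiv, hdiv] at hts'
        rw [hval x (Finset.ne_of_mem_erase ht), hval z (Finset.ne_of_mem_erase hs),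
          Fin.ext hts']
      · intro v hv
        obtain ⟨x, -, rfl⟩ := Finset.mem_image.1 hv
        by_cases hx : φ x = φ y
        · refine ⟨φ j, Finset.mem_erase.2 ⟨?_, hmem j⟩, Fin.ext ?_⟩
          · simp [φ, hlt, hjy]
          · change φ j / 2 = f x
            rw [← hdiv x, hx, hdiv, hdiv, hjy]
        · exact ⟨φ x, Finset.mem_erase.2 ⟨hx, hmem x⟩, Fin.ext (hdiv x)⟩
    have hrange : (Set.range f).ncard = (Finset.univ.image f).card := by
      rw [← Set.ncard_coe_finset]
      simp
    rw [← Finset.card_erase_add_one (hmem y), herase, ← hrange, hr]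
  let e : Fin r ≃o T := T.orderIsoOfFin hcard
  have hlt' : ∀ i, (e i : ℕ) / 2 < m := by
    intro i
    obtain ⟨x, -, hx⟩ := Finset.mem_image.1 (e i).2
    rw [← hx, hdiv]
    exact (f x).2
  refine ⟨fun x => e.symm ⟨φ x, hmem x⟩, fun i => ⟨(e i : ℕ) / 2, hlt' i⟩, ?_, ?_, ?_, ?_⟩
  · exact fun x z hxz => e.symm.monotone (hφ hxz)
  · intro i k hik
    have h : (e i : ℕ) ≤ e k := e.monotone hik
    exact Nat.div_le_div_right h
  · intro i
    obtain ⟨x, -, hx⟩ := Finset.mem_image.1 (e i).2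
    exact ⟨x, by simp [hx]⟩
  · intro x
    apply Fin.ext
    simp [hdiv]

/-- If `Y ⊆ {1,…,n}` (modeled by `Fin n`) with `|Y| = r`, `1 < r < n`, and
`α ∈ O_n(Y)` has `|range α| = r - 1`, then `α = βγ` for some `β, γ ∈ O_n(Y)` with
`|range β| = r`, `|range γ| = r - 1` and `γ` regular in `O_n(Y)`.
Products are written left-to-right: `(βγ)(x) = γ(β(x))`. -/
theorem factorization_rank_r_minus_one
    (n r : ℕ) (Y : Set (Fin n)) (hr1 : 1 < r) (hrn : r < n) (hYr : Y.ncard = r)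
    (α : Fin n →o Fin n) (hα : ∀ x, α x ∈ Y)
    (hrank : (Set.range ⇑α).ncard = r - 1) :
    ∃ β γ : Fin n →o Fin n,
      (∀ x, β x ∈ Y) ∧ (∀ x, γ x ∈ Y) ∧
      (∀ x, γ (β x) = α x) ∧
      (Set.range ⇑β).ncard = r ∧
      (Set.range ⇑γ).ncard = r - 1 ∧
      (∃ δ : Fin n →o Fin n, (∀ x, δ x ∈ Y) ∧ ∀ x, γ (δ (γ x)) = γ x) := by
  classical
  have hinj : ¬ Function.Injective α := by
    intro h
    rw [← Set.image_univ, Set.ncard_image_of_injective _ h, Set.ncard_univ,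
      Nat.card_eq_fintype_card, Fintype.card_fin] at hrank
    omega
  obtain ⟨b, g, hb, hg, hsurj, hgb⟩ :=
    α.monotone.exists_factor_through_fin_ncard_range_succ hinj (r := r) (by omega)
  let e : Fin r ↪o Fin n :=
    Y.toFinset.orderEmbOfFin (by rw [← Set.ncard_eq_toFinset_card', hYr])
  have he : ∀ i, e i ∈ Y := fun i => Set.mem_toFinset.1 (Finset.orderEmbOfFin_mem _ _ i)
  have : NeZero r := ⟨by omega⟩
  obtain ⟨p, hp, hpe'⟩ := e.monotone.exists_monotone_generalized_inverse
  have hpe : ∀ i, p (e i) = i := fun i => e.injective (hpe' i)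
  obtain ⟨s, hs, hgs⟩ := hg.exists_monotone_generalized_inverse
  have hgY : ∀ i, g i ∈ Y := by
    intro i
    obtain ⟨x, rfl⟩ := hsurj i
    exact hgb x ▸ hα x
  refine ⟨⟨e ∘ b, e.monotone.comp hb⟩, ⟨g ∘ p, hg.comp hp⟩, fun x => he _, fun x => hgY _,
    fun x => ?_, ?_, ?_, ⟨e ∘ s, e.monotone.comp hs⟩, fun x => he _, fun x => ?_⟩
  · simp [hpe, hgb]
  · change (Set.range (e ∘ b)).ncard = r
    rw [hsurj.range_comp, ← Set.image_univ, Set.ncard_image_of_injective _ e.injective,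
      Set.ncard_univ, Nat.card_eq_fintype_card, Fintype.card_fin]
  · have hp_surj : Function.Surjective p := fun i => ⟨e i, hpe i⟩
    have hα_eq : ⇑α = g ∘ b := funext fun x => (hgb x).symm
    change (Set.range (g ∘ p)).ncard = r - 1
    rw [hp_surj.range_comp, ← hsurj.range_comp g, ← hα_eq, hrank]
  · simp [hpe, hgs]
end

section
/- Let n ∈ ℕ, let Y be a subset of {1,…,n} with r = |Y| and 1 < r < n, and let α ∈ O_n(Y) with |range(α)| = k where k < r − 1. Then α = βγ for some β, γ ∈ O_n(Y) such that |range(β)| = |range(γ)| = k + 1. -/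
/-- A map that is monotone on a finite nonempty subset `T` of a linear order extends to a monotone
map all of whose values are attained on `T`. -/
theorem exists_monotone_extension_of_finset {L M : Type*} [LinearOrder L] [Preorder M]
    {T : Finset L} (hT : T.Nonempty) (f : T → M) (hf : Monotone f) :
    ∃ g : L →o M, (∀ t : T, g t = f t) ∧ Set.range g = Set.range f := by
  let U : L → Finset L := fun t => insert (T.min' hT) (T.filter (· ≤ t))
  have hU : ∀ t, (U t).Nonempty := fun t => Finset.insert_nonempty _ _
  have hUT : ∀ t, U t ⊆ T := fun t =>
    Finset.insert_subset (T.min'_mem hT) (Finset.filter_subset _ _)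
  let ρ : L → T := fun t => ⟨(U t).max' (hU t), hUT t ((U t).max'_mem (hU t))⟩
  have hρ : Monotone ρ := fun s t hst =>
    Finset.max'_subset (hU s) (Finset.insert_subset_insert _
      (Finset.monotone_filter_right T fun _ _ h => h.trans hst))
  have hρT : ∀ t : T, ρ t = t := by
    intro t
    refine Subtype.ext (le_antisymm (Finset.max'_le _ (hU t) _ ?_) (Finset.le_max' _ _ ?_))
    · intro u hu
      rcases Finset.mem_insert.1 hu with rfl | hu
      · exact T.min'_le _ t.2
      · exact (Finset.mem_filter.1 hu).2
    · exact Finset.mem_insert_of_mem (Finset.mem_filter.2 ⟨t.2, le_rfl⟩)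
  refine ⟨⟨f ∘ ρ, hf.comp hρ⟩, fun t => congrArg f (hρT t), ?_⟩
  exact (show Function.Surjective ρ from fun t => ⟨t, hρT t⟩).range_comp f

/-- Splitting the fibre of a monotone map `α` over `α p` just after `p` gives a monotone map into
the lexicographic product whose range has one more element. -/
theorem exists_monotone_lift_split_fibre {L M : Type*} [LinearOrder L] [LinearOrder M]
    (α : L →o M) {p q : L} (hpq : p < q) (hα : α p = α q) :
    ∃ b : L →o M ×ₗ Bool, (∀ x, (ofLex (b x)).1 = α x) ∧
      Set.range b = insert (toLex (α p, true)) ((fun a => toLex (a, false)) '' Set.range α) := by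
  refine ⟨⟨fun x => toLex (α x, decide (p < x ∧ α x = α p)), ?_⟩, fun x => rfl, ?_⟩
  · intro x x' hx
    refine Prod.Lex.toLex_le_toLex.2 ((α.monotone hx).lt_or_eq.imp id fun h => ⟨h, ?_⟩)
    simp only [Bool.le_iff_imp, decide_eq_true_eq]
    exact fun ⟨h₁, h₂⟩ => ⟨h₁.trans_le hx, h.symm.trans h₂⟩
  · ext z
    constructor
    · rintro ⟨x, rfl⟩
      by_cases h : p < x ∧ α x = α p
      · exact Or.inl (by simp [h])
      · exact Or.inr ⟨α x, ⟨x, rfl⟩, by simpa using h⟩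
    · rintro (rfl | ⟨_, ⟨x, rfl⟩, rfl⟩)
      · exact ⟨q, by simp [hpq, hα]⟩
      · by_cases h : α x = α p
        · exact ⟨p, by simp [h]⟩
        · exact ⟨x, by simp [h]⟩


/-- If `Y ⊆ {1,…,n}` (modeled by `Fin n`) with `|Y| = r`, `1 < r < n`, and
`α ∈ O_n(Y)` has `|range α| = k` with `k < r - 1`, then `α = βγ` for some
`β, γ ∈ O_n(Y)` with `|range β| = |range γ| = k + 1`.
Products are written left-to-right: `(βγ)(x) = γ(β(x))`. -/
theorem factorization_small_rank
    (n r k : ℕ) (Y : Set (Fin n)) (hr1 : 1 < r) (hrn : r < n) (hYr : Y.ncard = r)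
    (α : Fin n →o Fin n) (hα : ∀ x, α x ∈ Y)
    (hrank : (Set.range ⇑α).ncard = k) (hk : k < r - 1) :
    ∃ β γ : Fin n →o Fin n,
      (∀ x, β x ∈ Y) ∧ (∀ x, γ x ∈ Y) ∧
      (∀ x, γ (β x) = α x) ∧
      (Set.range ⇑β).ncard = k + 1 ∧
      (Set.range ⇑γ).ncard = k + 1 := by
  classical
  have hninj : ¬ Function.Injective α := by
    intro h
    rw [Set.ncard_range_of_injective h, Nat.card_fin] at hrank
    omega
  obtain ⟨p, q, hpq, hαpq⟩ : ∃ p q, p < q ∧ α p = α q := by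
    simp only [Function.Injective, not_forall] at hninj
    obtain ⟨p, q, h, hne⟩ := hninj
    rcases lt_or_gt_of_ne hne with hlt | hlt
    exacts [⟨p, q, hlt, h⟩, ⟨q, p, hlt, h.symm⟩]
  obtain ⟨y, hyY, hyα⟩ := Set.exists_mem_notMem_of_ncard_lt_ncard
    (show (Set.range α).ncard < Y.ncard by omega)
  obtain ⟨b, hbα, hb⟩ := exists_monotone_lift_split_fibre α hpq hαpq
  have hbcard : (Set.range b).ncard = k + 1 := by
    rw [hb, Set.ncard_insert_of_notMem (by simp), Set.ncard_image_of_injective _ _, hrank]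
    intro a a' h
    simpa using h
  have hyb : toLex (y, false) ∉ Set.range b := by
    rintro ⟨x, hx⟩
    exact hyα ⟨x, by rw [← hbα, hx]; rfl⟩
  let S : Finset (Fin n ×ₗ Bool) := (insert (toLex (y, false)) (Set.range b)).toFinset
  have hmemS : ∀ z, z ∈ S ↔ z = toLex (y, false) ∨ z ∈ Set.range b := by simp [S]
  have hS : S.card = k + 2 := by
    rw [← Set.ncard_eq_toFinset_card', Set.ncard_insert_of_notMem hyb, hbcard]
  obtain ⟨T, hTY, hT⟩ := Finset.exists_subset_card_eq
    (show k + 2 ≤ Y.toFinset.card by rw [← Set.ncard_eq_toFinset_card']; omega)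
  let e : S ≃o T := (S.orderIsoOfFin hS).symm.trans (T.orderIsoOfFin hT)
  have hbS : ∀ x, b x ∈ S := fun x => (hmemS _).2 (Or.inr ⟨x, rfl⟩)
  let β : Fin n →o Fin n :=
    ⟨fun x => e ⟨b x, hbS x⟩, fun x x' h => e.monotone (b.monotone h)⟩
  obtain ⟨γ, hγT, hγ⟩ := exists_monotone_extension_of_finset
    (Finset.card_pos.1 (by omega)) (fun t : T => (ofLex (e.symm t).1).1)
    (fun s t h => Prod.Lex.monotone_fst _ _ (e.symm.monotone h))
  have hγrange : Set.range γ = insert y (Set.range α) := by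
    rw [hγ]
    ext a
    constructor
    · rintro ⟨t, rfl⟩
      rcases (hmemS _).1 (e.symm t).2 with h | ⟨x, h⟩
      · exact Or.inl (by simp [h])
      · exact Or.inr ⟨x, by simp [← h, hbα]⟩
    · rintro (rfl | ⟨x, rfl⟩)
      · exact ⟨e ⟨toLex (a, false), (hmemS _).2 (Or.inl rfl)⟩, by simp⟩
      · exact ⟨e ⟨b x, hbS x⟩, by simp [hbα]⟩
  refine ⟨β, γ, fun x => Set.mem_toFinset.1 (hTY (e _).2), fun x => ?_, fun x => ?_, ?_, ?_⟩
  · have hx : γ x ∈ insert y (Set.range α) := hγrange ▸ Set.mem_range_self x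
    rcases hx with h | ⟨x', h⟩
    · exact h ▸ hyY
    · exact h ▸ hα x'
  · exact (hγT _).trans (by simp [hbα])
  · have hβ : Set.range β = (Subtype.val ∘ e) '' (Subtype.val ⁻¹' Set.range b) := by
      ext a
      constructor
      · rintro ⟨x, rfl⟩
        exact ⟨⟨b x, hbS x⟩, ⟨x, rfl⟩, rfl⟩
      · rintro ⟨⟨_, _⟩, ⟨x, rfl⟩, rfl⟩
        exact ⟨x, rfl⟩
    rw [hβ, Set.ncard_image_of_injective _ (Subtype.val_injective.comp e.injective),
      Set.ncard_preimage_of_injective_subset_range Subtype.val_injective ?_, hbcard]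
    rintro _ ⟨x, rfl⟩
    exact ⟨⟨b x, hbS x⟩, rfl⟩
  · rw [hγrange, Set.ncard_insert_of_notMem hyα, hrank]
end

section
/- Let n ∈ ℕ and let Y be a subset of {1,…,n} with r = |Y| and 1 < r < n. Set A = {α ∈ O_n(Y) : range(α) = Y} and B = {α ∈ O_n(Y) : α is regular in O_n(Y) and |range(α)| = r − 1}. Then the semigroup O_n(Y) is generated by A ∪ B (every element of O_n(Y) is a finite product of elements of A ∪ B); moreover, every generating set of O_n(Y) must contain A. -/
/-- The semigroup `O_n(Y)` of order-preserving self-maps of `Fin n` with range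
contained in `Y`. -/
def OnY (n : ℕ) (Y : Set (Fin n)) : Type :=
  {f : Fin n →o Fin n // ∀ x, f x ∈ Y}

/-- The product of `O_n(Y)`, written left-to-right: `(a * b)(x) = b(a(x))`. -/
instance (n : ℕ) (Y : Set (Fin n)) : Mul (OnY n Y) :=
  ⟨fun a b => ⟨b.1.comp a.1, fun x => b.2 (a.1 x)⟩⟩

/-- The greatest index `i` with `e i ≤ x` (or `0` if there is none) is a monotone left inverse
of the order embedding `e`. -/
theorem exists_monotone_leftInverse {n s : ℕ} (e : Fin (s + 1) ↪o Fin n) :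
    ∃ ρ : Fin n →o Fin (s + 1), (∀ i, ρ (e i) = i) ∧
      ∀ x i, e i ≤ x → i ≤ ρ x ∧ e (ρ x) ≤ x := by
  refine ⟨⟨fun x => (Finset.univ.filter fun i => e i ≤ x).sup id, fun x y hxy =>
    Finset.sup_mono fun i hi => ?_⟩, fun i => ?_, fun x i hi => ⟨?_, ?_⟩⟩
  · simp only [Finset.mem_filter, Finset.mem_univ, true_and] at hi ⊢
    exact hi.trans hxy
  · change (Finset.univ.filter fun j => e j ≤ e i).sup id = i
    refine le_antisymm (Finset.sup_le fun j hj => ?_) (Finset.le_sup (f := id) (b := i) ?_)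
    · simpa using hj
    · simp
  · change i ≤ (Finset.univ.filter fun i => e i ≤ x).sup id
    exact Finset.le_sup (f := id) (b := i) (by simpa using hi)
  · obtain ⟨j, hj, hjs⟩ := Finset.exists_mem_eq_sup (Finset.univ.filter fun i => e i ≤ x)
      ⟨i, by simpa using hi⟩ id
    have hjx : e j ≤ x := by simpa using hj
    change e ((Finset.univ.filter fun i => e i ≤ x).sup id) ≤ x
    rw [hjs]
    exact hjx

/-- An order-preserving map into a chain no longer than its domain factors through a surjective
order-preserving map onto that chain. -/
theorem exists_surjective_factorization {n s : ℕ} (hsn : s + 1 ≤ n) (p : Fin n →o Fin (s + 1)) :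
    ∃ (b : Fin n →o Fin (s + 1)) (g : Fin (s + 1) →o Fin (s + 1)),
      Function.Surjective b ∧ p = g.comp b := by
  classical
  let K : Finset (Fin n) := Finset.univ.filter fun x => ∀ y < x, p y < p x
  have hK : K.card ≤ s + 1 := by
    have hinj : Set.InjOn p (K : Set (Fin n)) := by
      intro x hx y hy hxy
      simp only [K, Finset.coe_filter, Finset.mem_univ, true_and, Set.mem_ofPred_eq] at hx hy
      rcases lt_trichotomy x y with h | h | h
      · exact absurd hxy (hy x h).ne
      · exact h
      · exact absurd hxy (hx y h).ne'
    simpa using Finset.card_le_card_of_injOn (t := Finset.univ) p (by simp) hinj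
  obtain ⟨J, hKJ, -, hJ⟩ := Finset.exists_subsuperset_card_eq (Finset.subset_univ K) hK
    (by simpa using hsn)
  obtain ⟨b, hb, hmax⟩ := exists_monotone_leftInverse (J.orderEmbOfFin hJ)
  refine ⟨b, p.comp (J.orderEmbOfFin hJ).toOrderHom, fun i => ⟨_, hb i⟩, ?_⟩
  ext1
  funext x
  obtain ⟨z, hz, hzmin⟩ := exists_minimal_of_wellFoundedLT (fun z => p z = p x) ⟨x, rfl⟩
  have hmin : ∀ w, p w = p x → z ≤ w := fun w hw =>
    (le_total z w).elim id fun h => hzmin hw h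
  have hzJ : z ∈ J := hKJ <| by
    simp only [K, Finset.mem_filter, Finset.mem_univ, true_and]
    exact fun y hy => lt_of_le_of_ne (p.monotone hy.le) fun h =>
      absurd (hmin y (h.trans hz)) (not_le.mpr hy)
  obtain ⟨i, rfl⟩ : z ∈ Set.range (J.orderEmbOfFin hJ) := by simpa using hzJ
  obtain ⟨hi, hle⟩ := hmax x i (hmin x rfl)
  change p x = p (J.orderEmbOfFin hJ (b x))
  refine le_antisymm ?_ (p.monotone hle)
  rw [← hz]
  exact p.monotone ((J.orderEmbOfFin hJ).monotone hi)

/-- The self-map of a finite chain moving `i` to an adjacent element `j` and fixing everything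
else. -/
def adjacentCollapse {r : ℕ} (i j : Fin r) (h : i.1 + 1 = j.1 ∨ j.1 + 1 = i.1) :
    Fin r →o Fin r :=
  ⟨fun x => if x = i then j else x, fun x y hxy => by
    dsimp only
    split_ifs <;> simp only [Fin.ext_iff, Fin.le_def] at * <;> omega⟩

theorem adjacentCollapse_apply {r : ℕ} (i j : Fin r) (h : i.1 + 1 = j.1 ∨ j.1 + 1 = i.1)
    (x : Fin r) : adjacentCollapse i j h x = if x = i then j else x := rfl

theorem adjacentCollapse_idem {r : ℕ} (i j : Fin r) (h : i.1 + 1 = j.1 ∨ j.1 + 1 = i.1)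
    (x : Fin r) : adjacentCollapse i j h (adjacentCollapse i j h x) = adjacentCollapse i j h x := by
  simp only [adjacentCollapse_apply]
  split_ifs <;> simp_all

theorem range_adjacentCollapse {r : ℕ} (i j : Fin r) (h : i.1 + 1 = j.1 ∨ j.1 + 1 = i.1) :
    Set.range (adjacentCollapse i j h) = {i}ᶜ := by
  have hji : j ≠ i := by rintro rfl; omega
  ext x
  simp only [Set.mem_range, Set.mem_compl_iff, Set.mem_singleton_iff, adjacentCollapse_apply]
  constructor
  · rintro ⟨y, rfl⟩
    split_ifs with hy
    · exact hji
    · exact hy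
  · exact fun hx => ⟨x, if_neg hx⟩

/-- The total displacement of a self-map of a finite chain. -/
def displacement {r : ℕ} (f : Fin r →o Fin r) : ℕ :=
  ∑ x, ((f x : ℤ) - (x : ℤ)).natAbs

/-- Moving the value of `f` at `k` from `j` to an adjacent `i` outside the range of `f` exhibits `f`
as a collapse of another order-preserving map. -/
theorem exists_factor_of_update {r : ℕ} (f : Fin r →o Fin r) (i k : Fin r)
    (h : i.1 + 1 = (f k).1 ∨ (f k).1 + 1 = i.1) (hi : ∀ x, f x ≠ i)
    (hlt : ∀ x < k, f x ≤ i) (hgt : ∀ x, k < x → i ≤ f x)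
    (hd : ((i : ℤ) - (k : ℤ)).natAbs < ((f k : ℤ) - (k : ℤ)).natAbs) :
    ∃ f' : Fin r →o Fin r, displacement f' < displacement f ∧
      f = (adjacentCollapse i (f k) h).comp f' := by
  refine ⟨⟨fun x => if x = k then i else f x, fun x y hxy => ?_⟩, ?_, ?_⟩
  · dsimp only
    split_ifs with hx hy hy
    · exact le_rfl
    · exact hgt y (lt_of_le_of_ne (hx ▸ hxy) (Ne.symm hy))
    · exact hlt x (lt_of_le_of_ne (hy ▸ hxy) hx)
    · exact f.monotone hxy
  · refine Finset.sum_lt_sum (fun x _ => ?_) ⟨k, Finset.mem_univ k, ?_⟩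
    · change (((if x = k then i else f x : Fin r) : ℤ) - (x : ℤ)).natAbs ≤ _
      split_ifs with hx
      · exact hx ▸ hd.le
      · exact le_rfl
    · change (((if k = k then i else f k : Fin r) : ℤ) - (k : ℤ)).natAbs < _
      rwa [if_pos rfl]
  · ext1
    funext x
    change f x = adjacentCollapse i (f k) h (if x = k then i else f x)
    by_cases hx : x = k
    · simp [hx, adjacentCollapse_apply]
    · simp [hx, adjacentCollapse_apply, hi x]

theorem exists_adjacentCollapse_comp {r : ℕ} (f : Fin r →o Fin r) (hf : f ≠ OrderHom.id) :
    ∃ (i j : Fin r) (h : i.1 + 1 = j.1 ∨ j.1 + 1 = i.1) (f' : Fin r →o Fin r),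
      displacement f' < displacement f ∧ f = (adjacentCollapse i j h).comp f' := by
  by_cases hup : ∃ k, k < f k
  · obtain ⟨k, hk, hmin⟩ := exists_minimal_of_wellFoundedLT (fun k => k < f k) hup
    have hbelow : ∀ x < k, f x ≤ x := fun x hx =>
      not_lt.mp fun h => absurd (hmin h hx.le) (not_le.mpr hx)
    have habove : ∀ x, k ≤ x → f k ≤ f x := fun x hx => f.monotone hx
    simp only [Fin.lt_def, Fin.le_def] at hk hbelow habove
    have hlt := (f k).isLt
    refine ⟨⟨(f k).1 - 1, by omega⟩, f k, Or.inl (by simp only; omega),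
      exists_factor_of_update f _ k _ (fun x hx => ?_) (fun x hx => ?_) (fun x hx => ?_) ?_⟩
    · have := hbelow x
      have := habove x
      simp only [Fin.ext_iff] at hx
      omega
    · have := hbelow x hx
      simp only [Fin.lt_def, Fin.le_def] at hx ⊢
      omega
    · have := habove x hx.le
      simp only [Fin.le_def]
      omega
    · simp only
      omega
  · have hdown : ∃ k, f k < k := by
      by_contra! hle
      push Not at hup
      exact hf (OrderHom.ext _ _ (funext fun x => le_antisymm (hup x) (hle x)))
    obtain ⟨k, hk, hmax⟩ := exists_maximal_of_wellFoundedGT (fun k => f k < k) hdown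
    have habove : ∀ x, k < x → x ≤ f x := fun x hx =>
      not_lt.mp fun h => absurd (hmax h hx.le) (not_le.mpr hx)
    have hbelow : ∀ x, x ≤ k → f x ≤ f k := fun x hx => f.monotone hx
    simp only [Fin.lt_def, Fin.le_def] at hk hbelow habove
    have hlt := k.isLt
    refine ⟨⟨(f k).1 + 1, by omega⟩, f k, Or.inr rfl,
      exists_factor_of_update f _ k _ (fun x hx => ?_) (fun x hx => ?_) (fun x hx => ?_) ?_⟩
    · have := hbelow x
      have := habove x
      simp only [Fin.ext_iff] at hx
      omega
    · have := hbelow x hx.le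
      simp only [Fin.le_def]
      omega
    · have := habove x hx
      simp only [Fin.lt_def, Fin.le_def] at hx ⊢
      omega
    · simp only
      omega

namespace OnY

variable {n : ℕ} {Y : Set (Fin n)}

theorem mul_apply (a b : OnY n Y) (x : Fin n) : (a * b).1 x = b.1 (a.1 x) := rfl

theorem ext {a b : OnY n Y} (h : ∀ x, a.1 x = b.1 x) : a = b :=
  Subtype.ext (OrderHom.ext _ _ (funext h))

/-- The element of `O_n(Y)` obtained from an order-preserving map into a chain embedded in `Y`. -/
def ofChain {r : ℕ} (e : Fin r ↪o Fin n) (he : ∀ i, e i ∈ Y) (p : Fin n →o Fin r) : OnY n Y :=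
  ⟨e.toOrderHom.comp p, fun x => he (p x)⟩

theorem ofChain_apply {r : ℕ} (e : Fin r ↪o Fin n) (he : ∀ i, e i ∈ Y) (p : Fin n →o Fin r)
    (x : Fin n) : (ofChain e he p).1 x = e (p x) := rfl

theorem range_ofChain {r : ℕ} (e : Fin r ↪o Fin n) (he : ∀ i, e i ∈ Y) (p : Fin n →o Fin r) :
    Set.range (ofChain e he p).1 = e '' Set.range p :=
  Set.range_comp e p

theorem eq_and_range_eq_of_range_mul {a b : OnY n Y} (h : Set.range (a * b).1 = Y) :
    a * b = a ∧ Set.range a.1 = Y := by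
  let b' : Y → Y := fun y => ⟨b.1 y, b.2 y⟩
  have hmono : Monotone b' := fun x y hxy => b.1.monotone hxy
  have hsurj : Function.Surjective b' := by
    rintro ⟨y, hy⟩
    obtain ⟨x, hx⟩ := h.symm ▸ hy
    exact ⟨⟨a.1 x, a.2 x⟩, Subtype.ext hx⟩
  have hstrict : StrictMono b' :=
    hmono.strictMono_of_injective (Finite.injective_iff_surjective.mpr hsurj)
  have hid : ∀ y : Y, b.1 y = y := fun y =>
    congrArg Subtype.val (le_antisymm (hstrict.le_id y) (hstrict.id_le y))
  have hab : a * b = a := ext fun x => hid ⟨a.1 x, a.2 x⟩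
  exact ⟨hab, hab ▸ h⟩

end OnY

/-- With `A = {α ∈ O_n(Y) : range α = Y}` and
`B = {α ∈ O_n(Y) : α regular and |range α| = r - 1}`, the semigroup `O_n(Y)` is
generated by `A ∪ B`, and every generating set of `O_n(Y)` contains `A`. -/
theorem generating_set_of_OnY
    (n r : ℕ) (Y : Set (Fin n)) (hr1 : 1 < r) (hrn : r < n) (hYr : Y.ncard = r) :
    Subsemigroup.closure
        ({a : OnY n Y | Set.range ⇑a.1 = Y} ∪
         {a : OnY n Y | (∃ b : OnY n Y, a * b * a = a) ∧
            (Set.range ⇑a.1).ncard = r - 1}) = ⊤ ∧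
    ∀ G : Set (OnY n Y), Subsemigroup.closure G = ⊤ →
      {a : OnY n Y | Set.range ⇑a.1 = Y} ⊆ G := by
  constructor
  · obtain ⟨s, rfl⟩ : ∃ s, r = s + 1 := ⟨r - 1, by omega⟩
    classical
    have hcard : Y.toFinset.card = s + 1 := by rw [← Set.ncard_eq_toFinset_card', hYr]
    set e := Y.toFinset.orderEmbOfFin hcard
    have hrange : Set.range e = Y := by simp [e]
    have he : ∀ i, e i ∈ Y := fun i => hrange ▸ Set.mem_range_self i
    obtain ⟨ρ, hρ, -⟩ := exists_monotone_leftInverse e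
    set S := Subsemigroup.closure
        ({a : OnY n Y | Set.range ⇑a.1 = Y} ∪
         {a : OnY n Y | (∃ b : OnY n Y, a * b * a = a) ∧
            (Set.range ⇑a.1).ncard = s + 1 - 1})
    have hcollapse : ∀ i j h, OnY.ofChain e he ((adjacentCollapse i j h).comp ρ) ∈ S := by
      intro i j h
      refine Subsemigroup.subset_closure (Or.inr ⟨⟨OnY.ofChain e he
        ((adjacentCollapse i j h).comp ρ), OnY.ext fun x => ?_⟩, ?_⟩)
      · simp [OnY.mul_apply, OnY.ofChain_apply, hρ, adjacentCollapse_idem]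
      · have hsurj : Function.Surjective ρ := fun i => ⟨e i, hρ i⟩
        rw [OnY.range_ofChain, Set.ncard_image_of_injective _ e.injective, OrderHom.comp_coe,
          hsurj.range_comp, range_adjacentCollapse, Set.ncard_compl]
        simp
    have hcomp : ∀ (d : ℕ) (g : Fin (s + 1) →o Fin (s + 1)), displacement g = d →
        ∀ p, OnY.ofChain e he p ∈ S → OnY.ofChain e he (g.comp p) ∈ S := by
      intro d
      induction d using Nat.strong_induction_on with
      | _ d ih =>
        rintro g rfl p hp
        by_cases hg : g = OrderHom.id
        · simpa [hg] using hp
        · obtain ⟨i, j, h, g', hlt, hgg⟩ := exists_adjacentCollapse_comp g hg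
          have hmul : OnY.ofChain e he (g.comp p) = OnY.ofChain e he (g'.comp p) *
              OnY.ofChain e he ((adjacentCollapse i j h).comp ρ) := OnY.ext fun x => by
            have hx : g (p x) = adjacentCollapse i j h (g' (p x)) := DFunLike.congr_fun hgg (p x)
            simp [OnY.mul_apply, OnY.ofChain_apply, hρ, hx]
          rw [hmul]
          exact S.mul_mem (ih _ hlt g' rfl p hp) (hcollapse i j h)
    refine (Subsemigroup.eq_top_iff' S).mpr fun a => ?_
    obtain ⟨b, g, hb, hbg⟩ := exists_surjective_factorization hrn.le (ρ.comp a.1)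
    have ha : a = OnY.ofChain e he (g.comp b) := OnY.ext fun x => by
      obtain ⟨i, hi⟩ : a.1 x ∈ Set.range e := hrange.symm ▸ a.2 x
      rw [← hbg, OnY.ofChain_apply, OrderHom.comp_coe, Function.comp_apply, ← hi, hρ]
    rw [ha]
    refine hcomp _ g rfl b (Subsemigroup.subset_closure (Or.inl ?_))
    rw [Set.mem_ofPred_eq, OnY.range_ofChain, hb.range_eq, Set.image_univ, hrange]
  · intro G hG a ha
    have hmem : a ∈ Subsemigroup.closure G := hG ▸ Subsemigroup.mem_top a
    induction hmem using Subsemigroup.closure_induction with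
    | mem x hx => exact hx
    | mul x y _ _ ihx _ =>
      obtain ⟨hxy, hx⟩ := OnY.eq_and_range_eq_of_range_mul ha
      rw [hxy]
      exact ihx hx
end

section
/- Let n ∈ ℕ and let Y be a subset of {1,…,n} with r = |Y| and 1 < r < n. Then the rank of the semigroup O_n(Y), i.e., the minimum cardinality of a generating set of O_n(Y), equals C(n−1, r−1) + |Y^♯|, where Y^♯ = {y ∈ Y : y = 1, or y = n, or (1 < y < n and both y−1 ∈ Y and y+1 ∈ Y)} is the set of captive elements of Y and C(n−1, r−1) is the binomial coefficient. -/
/-- `y ∈ Fin n` is captive (w.r.t. `Y`) if it is the least element (`1` in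
1-indexed notation), or the greatest element (`n`), or both its immediate
predecessor and successor belong to `Y`. -/
def Captive (n : ℕ) (Y : Set (Fin n)) (y : Fin n) : Prop :=
  (y : ℕ) = 0 ∨ (y : ℕ) = n - 1 ∨
    ((∃ a ∈ Y, (a : ℕ) + 1 = (y : ℕ)) ∧ (∃ b ∈ Y, (b : ℕ) = (y : ℕ) + 1))

namespace OnY

open Finset

variable {n s : ℕ}

/-- The monotone self-map of `Fin (s + 1)` that identifies `j.castSucc` with `j.succ` and
omits the value `k`. -/
def collapse (j : Fin s) (k : Fin (s + 1)) : Fin (s + 1) →o Fin (s + 1) :=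
  k.succAboveOrderEmb.toOrderHom.comp j.predAboveOrderHom

theorem collapse_apply (j : Fin s) (k x : Fin (s + 1)) :
    collapse j k x = k.succAbove (j.predAbove x) := rfl

theorem val_collapse (j : Fin s) (k x : Fin (s + 1)) :
    (collapse j k x : ℕ) =
      if (x : ℕ) ≤ j then (if (x : ℕ) < k then (x : ℕ) else x + 1)
      else (if (x : ℕ) ≤ k then (x : ℕ) - 1 else x) := by
  simp only [collapse_apply, Fin.succAbove, Fin.predAbove, Fin.lt_def, Fin.val_castSucc]
  split_ifs <;> simp only [Fin.val_castSucc, Fin.val_succ, Fin.val_pred, Fin.coe_castPred] at * <;>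
    omega

theorem collapse_comp_collapse {j j' : Fin s} {k k' : Fin (s + 1)}
    (h : k = j'.castSucc ∨ k = j'.succ) (x : Fin (s + 1)) :
    collapse j' k' (collapse j k x) = collapse j k' x := by
  have h' : (k : ℕ) = j' ∨ (k : ℕ) = j' + 1 := by
    rcases h with rfl | rfl <;> simp
  ext
  simp only [val_collapse]
  split_ifs <;> omega

theorem range_collapse (j : Fin s) (k : Fin (s + 1)) :
    Set.range (collapse j k) = {k}ᶜ := by
  have : ⇑(collapse j k) = k.succAbove ∘ j.predAbove := rfl
  rw [this, Set.range_comp, (Fin.predAbove_surjective (p := j)).range_eq, Set.image_univ,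
    Fin.range_succAbove]

/-- The element of `O_n(Y)` that sends `x` to the `f x`-th element of `Y = range y`. -/
def ofIndex (y : Fin (s + 1) ↪o Fin n) (f : Fin n →o Fin (s + 1)) : OnY n (Set.range y) :=
  ⟨y.toOrderHom.comp f, fun x => ⟨f x, rfl⟩⟩

theorem ofIndex_injective (y : Fin (s + 1) ↪o Fin n) : Function.Injective (ofIndex y) := by
  intro f g h
  ext1
  funext x
  exact y.injective (DFunLike.congr_fun (congrArg Subtype.val h) x)

theorem ofIndex_surjective (y : Fin (s + 1) ↪o Fin n) : Function.Surjective (ofIndex y) := by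
  rintro ⟨a, ha⟩
  have ha' := ha
  choose f hf using ha'
  refine ⟨⟨f, fun x x' h => ?_⟩, Subtype.ext <| OrderHom.ext _ _ <| funext hf⟩
  rw [← y.le_iff_le, hf, hf]
  exact a.monotone h

theorem ofIndex_mul (y : Fin (s + 1) ↪o Fin n) (f g : Fin n →o Fin (s + 1)) :
    ofIndex y f * ofIndex y g = ofIndex y ((g.comp y.toOrderHom).comp f) := rfl

/-- A map that respects the order between finitely many prescribed points extends to a
monotone map. -/
theorem exists_extension {ι : Type*} (a : ι → Fin n) (b : ι → Fin (s + 1))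
    (hab : ∀ i j, a i ≤ a j → b i ≤ b j) : ∃ g : Fin n →o Fin (s + 1), ∀ i, g (a i) = b i := by
  classical
  let f : Fin n → Fin (s + 1) := fun x => if h : ∃ i, a i = x then b h.choose else 0
  have hf : ∀ i, f (a i) = b i := fun i => by
    have h : ∃ j, a j = a i := ⟨i, rfl⟩
    simp only [f, dif_pos h]
    exact le_antisymm (hab _ _ h.choose_spec.le) (hab _ _ h.choose_spec.ge)
  have hm : MonotoneOn f (Set.range a) := by
    rintro _ ⟨i, rfl⟩ _ ⟨j, rfl⟩ h
    rw [hf, hf]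
    exact hab i j h
  obtain ⟨g, hg, hgf⟩ := hm.exists_monotone_extension (Set.toFinite _).bddBelow
    (Set.toFinite _).bddAbove
  exact ⟨⟨g, hg⟩, fun i => (hgf ⟨i, rfl⟩).symm.trans (hf i)⟩

/-- A point outside `range y` separates the elements of index `< c` from those of index `≥ c`. -/
def Gap (y : Fin (s + 1) ↪o Fin n) (c : ℕ) : Prop :=
  ∃ w, ∀ x : Fin (s + 1), ((x : ℕ) < c → y x < w) ∧ (c ≤ x → w < y x)

theorem exists_surjective_of_gap {y : Fin (s + 1) ↪o Fin n} {c : ℕ} (hc : Gap y c) (j : Fin s)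
    (k : Fin (s + 1)) (hlt : ∀ x : Fin (s + 1), (x : ℕ) < c → collapse j k x ≤ k)
    (hge : ∀ x : Fin (s + 1), c ≤ x → k ≤ collapse j k x) :
    ∃ g : Fin n →o Fin (s + 1), Function.Surjective g ∧ ∀ x, g (y x) = collapse j k x := by
  obtain ⟨w, hw⟩ := hc
  obtain ⟨g, hg⟩ := exists_extension (fun o : Option (Fin (s + 1)) => o.elim w y)
    (fun o => o.elim k (collapse j k)) (by
      rintro (_ | i) (_ | j) h
      · exact le_rfl
      · exact hge j (not_lt.1 fun h' => absurd h ((hw j).1 h').not_ge)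
      · exact hlt i (not_le.1 fun h' => absurd h ((hw i).2 h').not_ge)
      · exact (collapse _ _).monotone (y.le_iff_le.1 h))
  refine ⟨g, fun t => ?_, fun x => hg (some x)⟩
  by_cases ht : t = k
  · exact ⟨w, (hg none).trans ht.symm⟩
  · obtain ⟨x, hx⟩ : t ∈ Set.range (collapse j k) := by rw [range_collapse]; exact ht
    exact ⟨y x, (hg (some x)).trans hx⟩

/-- A monotone map that is not surjective factors as a `collapse` after a monotone map with more
values. -/
theorem exists_eq_collapse_comp (hs : s < n) (f : Fin n →o Fin (s + 1))
    (hf : ¬ Function.Surjective f) :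
    ∃ (j : Fin s) (k : Fin (s + 1)) (g : Fin n →o Fin (s + 1)),
      (∀ x, f x = collapse j k (g x)) ∧ #(univ.image f) < #(univ.image g) := by
  obtain ⟨m, rfl⟩ : ∃ m, n = m + 1 := ⟨n - 1, by omega⟩
  simp only [Function.Surjective, not_forall, not_exists] at hf
  obtain ⟨k, hk⟩ := hf
  choose u hu using fun x => Fin.exists_succAbove_eq (hk x)
  have hum : Monotone u := fun a b h => by
    rw [← (Fin.strictMono_succAbove k).le_iff_le, hu, hu]
    exact f.monotone h
  obtain ⟨x, hx⟩ : ∃ x : Fin m, u x.castSucc = u x.succ := by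
    by_contra! h
    have : StrictMono u := Fin.strictMono_iff_lt_succ.2 fun i =>
      lt_of_le_of_ne (hum i.castSucc_lt_succ.le) (h i)
    have := Fintype.card_le_of_injective u this.injective
    simp at this
    omega
  set j := u x.castSucc with hj
  let g : Fin (m + 1) →o Fin (s + 1) :=
    ⟨fun z => if z ≤ x.castSucc then (u z).castSucc else (u z).succ, fun a b h => by
      have hab := hum h
      dsimp only
      split_ifs with h1 h2 <;> simp only [Fin.le_def, Fin.val_castSucc, Fin.val_succ] at * <;>
        omega⟩
  have hg : ∀ z, g z = if z ≤ x.castSucc then (u z).castSucc else (u z).succ := fun z => rfl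
  have hgu : ∀ z, j.predAbove (g z) = u z := fun z => by
    rw [hg]
    split_ifs with h
    · exact Fin.predAbove_castSucc_of_le _ _ (hum h)
    · exact Fin.predAbove_succ_of_le _ _ (hum (not_le.1 h).le)
  have hfg : ∀ z, f z = collapse j k (g z) := fun z => by rw [collapse_apply, hgu, hu]
  refine ⟨j, k, g, hfg, ?_⟩
  have himg : univ.image f = (univ.image g).image (collapse j k) := by
    rw [image_image]
    exact image_congr fun z _ => hfg z
  rw [himg]
  refine lt_of_le_of_ne card_image_le fun h => ?_
  have h1 : g x.castSucc = j.castSucc := by rw [hg, if_pos le_rfl]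
  have h2 : g x.succ = j.succ := by rw [hg, if_neg x.castSucc_lt_succ.not_ge, hx]
  have h12 : g x.castSucc = g x.succ := card_image_iff.1 h
    (mem_coe.2 (mem_image_of_mem _ (mem_univ _))) (mem_coe.2 (mem_image_of_mem _ (mem_univ _)))
    (by rw [← hfg, ← hfg, ← hu, ← hu, ← hx])
  rw [h1, h2] at h12
  exact (Fin.castSucc_lt_succ (i := j)).ne h12

/-- If every value exceeds the previous one by at most `1`, then all intermediate values occur. -/
theorem surjective_of_val_succ_le {m : ℕ} (f : Fin (m + 1) → Fin (s + 1)) (h0 : f 0 = 0)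
    (hlast : f (Fin.last m) = Fin.last s)
    (hstep : ∀ i : Fin m, (f i.succ : ℕ) ≤ f i.castSucc + 1) : Function.Surjective f := by
  have key : ∀ (z : Fin (m + 1)) (t : Fin (s + 1)), t ≤ f z → ∃ z', f z' = t := by
    intro z
    induction z using Fin.induction with
    | zero => exact fun t ht => ⟨0, le_antisymm (h0 ▸ Fin.zero_le t) ht⟩
    | succ i ih =>
      intro t ht
      by_cases h : t ≤ f i.castSucc
      · exact ih t h
      · refine ⟨i.succ, Fin.ext ?_⟩
        have := hstep i
        rw [Fin.le_def] at h ht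
        omega
  exact fun t => key (Fin.last m) t (hlast ▸ Fin.le_last t)

/-- The number of elements of `D` below `z`, where `i : Fin m` is placed between `i.castSucc` and
`i.succ`. -/
def countBelow {m : ℕ} (D : Finset (Fin m)) (z : Fin (m + 1)) : ℕ := #{i ∈ D | i.castSucc < z}

theorem countBelow_zero {m : ℕ} (D : Finset (Fin m)) : countBelow D 0 = 0 := by
  simp [countBelow]

theorem countBelow_last {m : ℕ} (D : Finset (Fin m)) : countBelow D (Fin.last m) = #D := by
  simp [countBelow, Fin.castSucc_lt_last]

theorem countBelow_mono {m : ℕ} (D : Finset (Fin m)) : Monotone (countBelow D) :=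
  fun _ _ h => card_le_card <| monotone_filter_right _ fun _ _ hi => hi.trans_le h

theorem countBelow_succ {m : ℕ} (D : Finset (Fin m)) (i : Fin m) :
    countBelow D i.succ = countBelow D i.castSucc + if i ∈ D then 1 else 0 := by
  simp only [countBelow, Fin.castSucc_lt_succ_iff, Fin.castSucc_lt_castSucc_iff]
  split_ifs with h
  · rw [← card_insert_of_notMem (a := i) (by simp)]
    congr 1
    ext j
    simp only [mem_filter, mem_insert, le_iff_lt_or_eq]
    constructor
    · rintro ⟨h1, h2 | h2⟩ <;> tauto
    · rintro (rfl | h1) <;> tauto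
  · congr 1
    ext j
    simp only [mem_filter, le_iff_lt_or_eq]
    constructor
    · rintro ⟨h1, h2 | rfl⟩ <;> tauto
    · tauto

theorem apply_zero_of_surjective {m : ℕ} {f : Fin (m + 1) →o Fin (s + 1)}
    (hf : Function.Surjective f) : f 0 = 0 := by
  obtain ⟨z, hz⟩ := hf 0
  exact le_antisymm (hz ▸ f.monotone (Fin.zero_le z)) (Fin.zero_le _)

theorem apply_last_of_surjective {m : ℕ} {f : Fin (m + 1) →o Fin (s + 1)}
    (hf : Function.Surjective f) : f (Fin.last m) = Fin.last s := by
  obtain ⟨z, hz⟩ := hf (Fin.last s)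
  exact le_antisymm (Fin.le_last _) (hz ▸ f.monotone (Fin.le_last z))

theorem val_succ_le_of_surjective {m : ℕ} {f : Fin (m + 1) →o Fin (s + 1)}
    (hf : Function.Surjective f) (i : Fin m) : (f i.succ : ℕ) ≤ f i.castSucc + 1 := by
  by_contra! h
  obtain ⟨z, hz⟩ := hf ⟨f i.castSucc + 1, h.trans (f i.succ).2⟩
  have hz' := congrArg Fin.val hz
  dsimp only at hz'
  rcases le_or_gt z i.castSucc with h' | h'
  · have := Fin.le_def.1 (f.monotone h')
    omega
  · have := Fin.le_def.1 (f.monotone (Fin.castSucc_lt_iff_succ_le.1 h'))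
    omega

/-- The set of jumps of a map. -/
def jumps {m : ℕ} (f : Fin (m + 1) →o Fin (s + 1)) : Finset (Fin m) :=
  {i | f i.castSucc < f i.succ}

theorem countBelow_jumps {m : ℕ} {f : Fin (m + 1) →o Fin (s + 1)}
    (hf : Function.Surjective f) (z : Fin (m + 1)) : countBelow (jumps f) z = f z := by
  induction z using Fin.induction with
  | zero => rw [countBelow_zero, apply_zero_of_surjective hf, Fin.val_zero]
  | succ i ih =>
    rw [countBelow_succ, ih]
    have h1 := val_succ_le_of_surjective hf i
    have h2 := Fin.le_def.1 (f.monotone i.castSucc_lt_succ.le)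
    simp only [jumps, mem_filter, mem_univ, true_and, Fin.lt_def]
    split_ifs <;> omega

theorem ncard_surjective (m s : ℕ) :
    {f : Fin (m + 1) →o Fin (s + 1) | Function.Surjective f}.ncard = m.choose s := by
  have hcard : #(powersetCard s (univ : Finset (Fin m))) = m.choose s := by simp
  rw [← hcard, ← Set.ncard_coe_finset]
  refine Set.ncard_congr (fun f _ => jumps f) (fun f hf => ?_) (fun f g hf hg h => ?_)
    (fun D hD => ?_)
  · rw [mem_coe, mem_powersetCard_univ, ← countBelow_last, countBelow_jumps hf,
      apply_last_of_surjective hf, Fin.val_last]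
  · ext z
    rw [← countBelow_jumps hf, ← countBelow_jumps hg, h]
  · rw [mem_coe, mem_powersetCard_univ] at hD
    have hlt : ∀ z, countBelow D z < s + 1 := fun z =>
      Nat.lt_succ_of_le (hD ▸ card_filter_le _ _)
    let f : Fin (m + 1) →o Fin (s + 1) :=
      ⟨fun z => ⟨countBelow D z, hlt z⟩, fun a b h => countBelow_mono D h⟩
    refine ⟨f, surjective_of_val_succ_le f (Fin.ext (countBelow_zero D))
      (Fin.ext ((countBelow_last D).trans hD)) (fun i => ?_), ?_⟩
    · change countBelow D i.succ ≤ countBelow D i.castSucc + 1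
      rw [countBelow_succ]
      split_ifs <;> omega
    · ext i
      simp only [jumps, mem_filter, mem_univ, true_and]
      change countBelow D i.castSucc < countBelow D i.succ ↔ _
      rw [countBelow_succ]
      split_ifs with h <;> simp [h]

/-- The combinatorial core of the generation argument: a relation on pairs (identified pair,
omitted value) that contains the pairs provided by the gaps, contains the pairs `(j₀, k)` with `k`
captive, and is closed under composition, is everything. -/
theorem exists_forall_of_gap (hs : 0 < s) (gap : ℕ → Prop) (captive : Fin (s + 1) → Prop)
    (hgap : ∃ c ≤ s + 1, gap c) (hzero : ¬ captive 0 → gap 0)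
    (hlast : ¬ captive (Fin.last s) → gap (s + 1))
    (hmid : ∀ k, ¬ captive k → gap k ∨ gap (k + 1)) :
    ∃ j₀ : Fin s, ∀ E : Fin s → Fin (s + 1) → Prop,
      (∀ j k j' k', E j k → E j' k' → ((k : ℕ) = j' ∨ (k : ℕ) = j' + 1) → E j k') →
      (∀ (j : Fin s) (k : Fin (s + 1)), gap k → (k : ℕ) ≤ j → E j k) →
      (∀ (j : Fin s) (k : Fin (s + 1)), gap (k + 1) → (j : ℕ) < k → E j k) →
      (∀ k, captive k → E j₀ k) → ∀ j k, E j k := by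
  have finish : ∀ E : Fin s → Fin (s + 1) → Prop,
      (∀ j k j' k', E j k → E j' k' → ((k : ℕ) = j' ∨ (k : ℕ) = j' + 1) → E j k') →
      (∀ (j : Fin s) (k : Fin (s + 1)), gap k → (k : ℕ) ≤ j → E j k) →
      (∀ (j : Fin s) (k : Fin (s + 1)), gap (k + 1) → (j : ℕ) < k → E j k) →
      (∀ j k, captive k → E j k) → ∀ j k, E j k := by
    intro E hcomp hlow hhigh hcap
    have h0 : ∀ j, E j 0 := fun j => by
      by_cases h : captive 0
      · exact hcap j 0 h
      · exact hlow j 0 (hzero h) (Nat.zero_le _)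
    have hl : ∀ j, E j (Fin.last s) := fun j => by
      by_cases h : captive (Fin.last s)
      · exact hcap j _ h
      · exact hhigh j _ (hlast h) j.2
    intro j k
    by_cases hk : captive k
    · exact hcap j k hk
    rcases hmid k hk with h | h
    · by_cases hks : (k : ℕ) = s
      · rw [show k = Fin.last s from Fin.ext hks]
        exact hl j
      · exact hcomp j (Fin.last s) ⟨s - 1, by omega⟩ k (hl j)
          (hlow _ _ h (by dsimp only; omega)) (Or.inr (by simp; omega))
    · by_cases hk0 : (k : ℕ) = 0
      · rw [show k = 0 from Fin.ext hk0]
        exact h0 j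
      · exact hcomp j 0 ⟨0, hs⟩ k (h0 j)
          (hhigh _ _ h (by dsimp only; omega)) (Or.inl (by simp))
  by_cases hint : ∃ c, 1 ≤ c ∧ c ≤ s ∧ gap c
  · obtain ⟨c, hc1, hcs, hc⟩ := hint
    refine ⟨⟨c - 1, by omega⟩, fun E hcomp hlow hhigh hcap => ?_⟩
    refine finish E hcomp hlow hhigh fun j k hk => ?_
    rcases lt_trichotomy (j : ℕ) (c - 1) with h | h | h
    · exact hcomp j ⟨c - 1, by omega⟩ _ k
        (hhigh j ⟨c - 1, by omega⟩ (by simpa only [Nat.sub_add_cancel hc1] using hc) h)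
        (hcap k hk) (Or.inl rfl)
    · rw [show j = ⟨c - 1, by omega⟩ from Fin.ext h]
      exact hcap k hk
    · exact hcomp j ⟨c, by omega⟩ _ k (hlow j ⟨c, by omega⟩ hc (by dsimp only; omega))
        (hcap k hk) (Or.inr (by dsimp only; omega))
  · by_cases hgl : gap (s + 1)
    · refine ⟨⟨s - 1, by omega⟩, fun E hcomp hlow hhigh hcap => ?_⟩
      refine finish E hcomp hlow hhigh fun j k hk => ?_
      exact hcomp j (Fin.last s) _ k (hhigh j _ hgl j.2) (hcap k hk) (Or.inr (by simp; omega))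
    · have hg0 : gap 0 := by
        obtain ⟨c, hcs, hc⟩ := hgap
        rcases Nat.eq_zero_or_pos c with rfl | hc0
        · exact hc
        · rcases hcs.eq_or_lt with rfl | hcs
          · exact absurd hc hgl
          · exact absurd ⟨c, hc0, Nat.lt_succ_iff.1 hcs, hc⟩ hint
      refine ⟨⟨0, hs⟩, fun E hcomp hlow hhigh hcap => ?_⟩
      refine finish E hcomp hlow hhigh fun j k hk => ?_
      exact hcomp j 0 _ k (hlow j 0 hg0 (Nat.zero_le _)) (hcap k hk) (Or.inl (by simp))

variable {y : Fin (s + 1) ↪o Fin n}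

theorem exists_gap (hs : s + 1 < n) (y : Fin (s + 1) ↪o Fin n) : ∃ c ≤ s + 1, Gap y c := by
  obtain ⟨w, hw⟩ : ∃ w, w ∉ Set.range y := by
    by_contra! h
    have := Fintype.card_le_of_surjective y h
    simp at this
    omega
  have hex : ∃ c : ℕ, ∀ x : Fin (s + 1), c ≤ x → w < y x := ⟨s + 1, fun x hx => by omega⟩
  classical
  refine ⟨Nat.find hex, Nat.find_min' hex fun x hx => by omega, w,
    fun x => ⟨fun hx => ?_, Nat.find_spec hex x⟩⟩
  by_contra h
  refine Nat.find_min hex hx fun x' hx' => ?_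
  have h1 : w < y x := lt_of_le_of_ne (not_lt.1 h) fun h' => hw ⟨x, h'.symm⟩
  exact h1.trans_le (y.monotone hx')

theorem gap_zero_of_not_captive (h : ¬ Captive n (Set.range y) (y 0)) : Gap y 0 := by
  have h0 : (y 0 : ℕ) ≠ 0 := fun h' => h (Or.inl h')
  refine ⟨⟨0, by omega⟩, fun x => ⟨fun hx => absurd hx (Nat.not_lt_zero _), fun _ => ?_⟩⟩
  have := Fin.le_def.1 (y.monotone (Fin.zero_le x))
  rw [Fin.lt_def]
  dsimp only
  omega

theorem gap_last_of_not_captive (h : ¬ Captive n (Set.range y) (y (Fin.last s))) :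
    Gap y (s + 1) := by
  have h0 : (y (Fin.last s) : ℕ) ≠ n - 1 := fun h' => h (Or.inr (Or.inl h'))
  refine ⟨⟨n - 1, by omega⟩, fun x => ⟨fun _ => ?_, fun hx => absurd x.2 hx.not_gt⟩⟩
  have := Fin.le_def.1 (y.monotone (Fin.le_last x))
  rw [Fin.lt_def]
  dsimp only
  omega

theorem gap_of_not_captive {k : Fin (s + 1)} (h : ¬ Captive n (Set.range y) (y k)) :
    Gap y k ∨ Gap y (k + 1) := by
  simp only [Captive, not_or, not_and_or, not_exists] at h
  obtain ⟨h0, hl, h | h⟩ := h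
  · refine Or.inl ⟨⟨y k - 1, by omega⟩, fun x => ⟨fun hx => ?_, fun hx => ?_⟩⟩
    · have h1 := Fin.lt_def.1 (y.strictMono (Fin.lt_def.2 hx))
      have h2 := (h (y x)).resolve_left (not_not.2 ⟨x, rfl⟩)
      rw [Fin.lt_def]
      dsimp only
      omega
    · have h1 := Fin.le_def.1 (y.monotone (Fin.le_def.2 hx))
      rw [Fin.lt_def]
      dsimp only
      omega
  · refine Or.inr ⟨⟨y k + 1, by omega⟩, fun x => ⟨fun hx => ?_, fun hx => ?_⟩⟩
    · have h1 := Fin.le_def.1 (y.monotone (Fin.le_def.2 (Nat.lt_succ_iff.1 hx)))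
      rw [Fin.lt_def]
      dsimp only
      omega
    · have h1 := Fin.lt_def.1 (y.strictMono (Fin.lt_def.2 hx))
      have h2 := (h (y x)).resolve_left (not_not.2 ⟨x, rfl⟩)
      rw [Fin.lt_def]
      dsimp only
      omega

/-- The elements of `O_n(Y)` whose range is the whole of `Y`. -/
def maxRank (y : Fin (s + 1) ↪o Fin n) : Set (OnY n (Set.range y)) :=
  ofIndex y '' {f | Function.Surjective f}

/-- The indices of the captive elements of `Y`. -/
def captiveIndices (y : Fin (s + 1) ↪o Fin n) : Set (Fin (s + 1)) :=
  {k | Captive n (Set.range y) (y k)}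

theorem eq_top_of_collapse_mem (hs : s < n) (S : Subsemigroup (OnY n (Set.range y)))
    (hmax : maxRank y ⊆ S)
    (hS : ∀ j k, ∃ g : Fin n →o Fin (s + 1), ofIndex y g ∈ S ∧ ∀ x, g (y x) = collapse j k x) :
    S = ⊤ := by
  rw [eq_top_iff]
  rintro a -
  obtain ⟨f, rfl⟩ := ofIndex_surjective y a
  induction h : s + 1 - #(univ.image f) using Nat.strong_induction_on generalizing f with
  | _ d ih =>
    by_cases hf : Function.Surjective f
    · exact hmax ⟨f, hf, rfl⟩
    obtain ⟨j, k, g, hfg, hcard⟩ := exists_eq_collapse_comp hs f hf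
    obtain ⟨e, he, hec⟩ := hS j k
    have hle : #(univ.image g) ≤ s + 1 := (card_le_univ _).trans_eq (Fintype.card_fin _)
    have hmul : ofIndex y g * ofIndex y e = ofIndex y f := by
      rw [ofIndex_mul]
      congr 1
      ext1
      funext x
      exact (hec (g x)).trans (hfg x).symm
    rw [← hmul]
    exact S.mul_mem (ih _ (by omega) g rfl) he

theorem exists_generating_set (hs0 : 0 < s) (hs : s + 1 < n) (y : Fin (s + 1) ↪o Fin n) :
    ∃ ε : Fin (s + 1) → OnY n (Set.range y),
      Subsemigroup.closure (maxRank y ∪ ε '' captiveIndices y) = ⊤ := by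
  obtain ⟨j₀, hj₀⟩ := exists_forall_of_gap hs0 (Gap y) (· ∈ captiveIndices y) (exists_gap hs y)
    gap_zero_of_not_captive gap_last_of_not_captive fun _ => gap_of_not_captive
  choose g hg using fun k => exists_extension y (collapse j₀ k) fun i j h =>
    (collapse j₀ k).monotone (y.le_iff_le.1 h)
  refine ⟨fun k => ofIndex y (g k), ?_⟩
  set G := maxRank y ∪ (fun k => ofIndex y (g k)) '' captiveIndices y with hG
  have hmax : maxRank y ⊆ Subsemigroup.closure G :=
    Set.subset_union_left.trans Subsemigroup.subset_closure
  refine eq_top_of_collapse_mem (by omega) _ hmax (hj₀ _ ?_ ?_ ?_ ?_)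
  · rintro j k j' k' ⟨f, hf, hfc⟩ ⟨f', hf', hfc'⟩ hk
    refine ⟨(f'.comp y.toOrderHom).comp f, Subsemigroup.mul_mem _ hf hf', fun x => ?_⟩
    change f' (y (f (y x))) = _
    rw [hfc, hfc', collapse_comp_collapse]
    exact hk.imp (fun h => Fin.ext h) (fun h => Fin.ext h)
  · intro j k hgap hkj
    obtain ⟨f, hf, hfc⟩ := exists_surjective_of_gap hgap j k
      (fun x hx => by rw [Fin.le_def, val_collapse]; split_ifs <;> omega)
      (fun x hx => by rw [Fin.le_def, val_collapse]; split_ifs <;> omega)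
    exact ⟨f, hmax ⟨f, hf, rfl⟩, hfc⟩
  · intro j k hgap hkj
    obtain ⟨f, hf, hfc⟩ := exists_surjective_of_gap hgap j k
      (fun x hx => by rw [Fin.le_def, val_collapse]; split_ifs <;> omega)
      (fun x hx => by rw [Fin.le_def, val_collapse]; split_ifs <;> omega)
    exact ⟨f, hmax ⟨f, hf, rfl⟩, hfc⟩
  · exact fun k hk => ⟨g k, Subsemigroup.subset_closure (Or.inr ⟨k, hk, rfl⟩), hg k⟩

theorem maxRank_subset {G : Set (OnY n (Set.range y))} (hG : Subsemigroup.closure G = ⊤) :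
    maxRank y ⊆ G := by
  intro a
  have ha : a ∈ Subsemigroup.closure G := hG ▸ Subsemigroup.mem_top a
  induction ha using Subsemigroup.closure_induction with
  | mem a ha => exact fun _ => ha
  | mul a b _ _ iha _ =>
    obtain ⟨f, rfl⟩ := ofIndex_surjective y a
    obtain ⟨g, rfl⟩ := ofIndex_surjective y b
    rintro ⟨h, hh, hfg⟩
    have hsurj : Function.Surjective ((g ∘ y) ∘ f) := by
      rw [ofIndex_mul] at hfg
      have := ofIndex_injective y hfg
      subst this
      exact hh
    have hgy : StrictMono (g ∘ y) := (g.monotone.comp y.monotone).strictMono_of_injective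
      (Finite.injective_iff_surjective.2 hsurj.of_comp)
    have hid : g ∘ y = id := funext fun x => le_antisymm hgy.apply_le hgy.le_apply
    rw [hid, Function.id_comp] at hsurj
    have hmul : ofIndex y f * ofIndex y g = ofIndex y f := by
      rw [ofIndex_mul]
      congr 1
      ext1
      funext x
      exact congrFun hid (f x)
    rw [hmul]
    exact iha ⟨f, hsurj, rfl⟩

theorem apply_eq_self_of_captive {k : Fin (s + 1)} (hk : k ∈ captiveIndices y)
    {g : Fin n →o Fin (s + 1)} (hg : Function.Surjective g)
    (hgy : ∀ t, t ≠ k → ∃ x, g (y x) = t) : g (y k) = k := by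
  obtain ⟨m, rfl⟩ : ∃ m, n = m + 1 := ⟨n - 1, by have := (y k).2; omega⟩
  have hlow : ∀ t : ℕ, t < k → ∀ x : Fin (s + 1), (g (y x) : ℕ) = t → t ≤ x := by
    intro t
    induction t with
    | zero => exact fun _ _ _ => Nat.zero_le _
    | succ t ih =>
      intro ht x hx
      obtain ⟨x', hx'⟩ := hgy ⟨t, by omega⟩ (fun h => by simp only [Fin.ext_iff] at h; omega)
      have h1 := ih (by omega) x' (congrArg Fin.val hx')
      have h2 : x' < x := lt_of_not_ge fun h => by
        have := Fin.le_def.1 (g.monotone (y.monotone h))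
        rw [hx', hx] at this
        simp at this
      rw [Fin.lt_def] at h2
      omega
  have hhigh : ∀ d t : ℕ, t + d = s → k < t →
      ∀ x : Fin (s + 1), (g (y x) : ℕ) = t → x ≤ t := by
    intro d
    induction d with
    | zero => intro t ht _ x _; omega
    | succ d ih =>
      intro t ht hkt x hx
      obtain ⟨x', hx'⟩ := hgy ⟨t + 1, by omega⟩ (fun h => by simp only [Fin.ext_iff] at h; omega)
      have h1 := ih (t + 1) (by omega) (by omega) x' (congrArg Fin.val hx')
      have h2 : x < x' := lt_of_not_ge fun h => by
        have := Fin.le_def.1 (g.monotone (y.monotone h))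
        rw [hx', hx] at this
        simp at this
      rw [Fin.lt_def] at h2
      omega
  rcases hk with hk | hk | ⟨⟨_, ⟨a, rfl⟩, ha⟩, ⟨_, ⟨b, rfl⟩, hb⟩⟩
  · have hyk : y k = 0 := Fin.ext hk
    have hk0 : k = 0 := by
      refine le_antisymm (y.le_iff_le.1 ?_) (Fin.zero_le _)
      rw [hyk]
      exact Fin.zero_le _
    rw [hyk, apply_zero_of_surjective hg, hk0]
  · have hyk : y k = Fin.last m := Fin.ext hk
    have hks : k = Fin.last s := by
      refine le_antisymm (Fin.le_last _) (y.le_iff_le.1 ?_)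
      rw [hyk]
      exact Fin.le_last _
    rw [hyk, apply_last_of_surjective hg, hks]
  · obtain ⟨w, hw⟩ := hg k
    have hak : a < k := y.lt_iff_lt.1 (Fin.lt_def.2 (by omega))
    have hkb : k < b := y.lt_iff_lt.1 (Fin.lt_def.2 (by omega))
    have haw : y a < w := by
      obtain ⟨x, hx⟩ := hgy a hak.ne
      have h1 : a ≤ x := hlow a hak x (congrArg Fin.val hx)
      refine lt_of_not_ge fun h => ?_
      have h2 := g.monotone (h.trans (y.monotone h1))
      rw [hw, hx] at h2
      exact h2.not_gt hak
    have hwb : w < y b := by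
      obtain ⟨x, hx⟩ := hgy b hkb.ne'
      have h1 : x ≤ b := hhigh (s - b) b (by omega) hkb x (congrArg Fin.val hx)
      refine lt_of_not_ge fun h => ?_
      have h2 := g.monotone ((y.monotone h1).trans h)
      rw [hw, hx] at h2
      exact h2.not_gt hkb
    have hwk : w = y k := Fin.ext (by rw [Fin.lt_def] at haw hwb; omega)
    rw [← hwk, hw]

theorem exists_mem_range_eq_compl {G : Set (OnY n (Set.range y))}
    (hG : Subsemigroup.closure G = ⊤) {k : Fin (s + 1)} (hk : k ∈ captiveIndices y)
    (f : Fin n →o Fin (s + 1)) (hf : Set.range f = {k}ᶜ) :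
    ∃ g : Fin n →o Fin (s + 1), ofIndex y g ∈ G ∧ Set.range g = {k}ᶜ := by
  obtain ⟨a, ha⟩ : ∃ a, a = ofIndex y f := ⟨_, rfl⟩
  have haG : a ∈ Subsemigroup.closure G := hG ▸ Subsemigroup.mem_top a
  induction haG using Subsemigroup.closure_induction generalizing f with
  | mem a haG => exact ⟨f, ha ▸ haG, hf⟩
  | mul a b _ _ iha ihb =>
    obtain ⟨u, rfl⟩ := ofIndex_surjective y a
    obtain ⟨v, rfl⟩ := ofIndex_surjective y b
    rw [ofIndex_mul] at ha
    have := ofIndex_injective y ha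
    subst this
    have hmem : ∀ t, (∃ x, v (y (u x)) = t) ↔ t ≠ k := fun t => Set.ext_iff.1 hf t
    by_cases hv : Function.Surjective v
    · have hvk := apply_eq_self_of_captive hk hv fun t ht =>
        let ⟨x, hx⟩ := (hmem t).2 ht
        ⟨u x, hx⟩
      refine iha u (Set.eq_of_subset_of_ncard_le ?_ ?_) rfl
      · rintro _ ⟨x, rfl⟩ (h : u x = k)
        exact (hmem _).1 ⟨x, rfl⟩ (by rw [h, hvk])
      · calc ({k}ᶜ : Set (Fin (s + 1))).ncard = ((v ∘ y) '' Set.range u).ncard := by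
              rw [← hf, ← Set.range_comp]; rfl
          _ ≤ (Set.range u).ncard := Set.ncard_image_le
    · refine ihb v (Set.Subset.antisymm ?_ ?_) rfl
      · rintro _ ⟨x, rfl⟩ (h : v x = k)
        refine hv fun t => ?_
        by_cases ht : t = k
        · exact ⟨x, h.trans ht.symm⟩
        · obtain ⟨z, hz⟩ := (hmem t).2 ht
          exact ⟨_, hz⟩
      · intro t ht
        obtain ⟨z, hz⟩ := (hmem t).2 ht
        exact ⟨_, hz⟩

theorem ncard_maxRank (hn : 0 < n) (y : Fin (s + 1) ↪o Fin n) :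
    (maxRank y).ncard = (n - 1).choose s := by
  obtain ⟨m, rfl⟩ : ∃ m, n = m + 1 := ⟨n - 1, by omega⟩
  rw [maxRank, Set.ncard_image_of_injective _ (ofIndex_injective y), ncard_surjective,
    Nat.add_sub_cancel]

theorem finite_OnY (Y : Set (Fin n)) : Finite (OnY n Y) :=
  Finite.of_injective (fun a : OnY n Y => (a.1 : Fin n → Fin n)) fun _ _ h =>
    Subtype.ext (DFunLike.coe_injective h)

theorem le_ncard_of_closure_eq_top (hs0 : 0 < s) (y : Fin (s + 1) ↪o Fin n)
    {G : Set (OnY n (Set.range y))} (hG : Subsemigroup.closure G = ⊤) :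
    (n - 1).choose s + (captiveIndices y).ncard ≤ G.ncard := by
  have := finite_OnY (Set.range y)
  have key : ∀ k : Fin (s + 1), ∃ g : Fin n →o Fin (s + 1),
      k ∈ captiveIndices y → ofIndex y g ∈ G ∧ Set.range g = {k}ᶜ := by
    intro k
    by_cases hk : k ∈ captiveIndices y
    · obtain ⟨f, hf⟩ := exists_extension y id fun _ _ h => y.le_iff_le.1 h
      have hfs : Function.Surjective f := fun t => ⟨y t, hf t⟩
      obtain ⟨g, hg⟩ := exists_mem_range_eq_compl hG hk ((collapse ⟨0, hs0⟩ k).comp f) (by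
        exact (hfs.range_comp (collapse ⟨0, hs0⟩ k)).trans (range_collapse _ _))
      exact ⟨g, fun _ => hg⟩
    · exact ⟨⟨fun _ => 0, fun _ _ _ => le_rfl⟩, fun h => absurd h hk⟩
  choose g hg using key
  have hinj : Set.InjOn (fun k => ofIndex y (g k)) (captiveIndices y) := by
    intro k hk k' hk' h
    have h' := ofIndex_injective y h
    have := (hg k hk).2
    rw [h', (hg k' hk').2] at this
    exact (Set.singleton_injective (compl_injective this)).symm
  have hdisj : Disjoint (maxRank y) ((fun k => ofIndex y (g k)) '' captiveIndices y) := by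
    rw [Set.disjoint_left]
    rintro _ ⟨f, hf, rfl⟩ ⟨k, hk, h⟩
    have h' := ofIndex_injective y h
    have h2 := (hg k hk).2
    rw [h', Function.Surjective.range_eq hf] at h2
    exact Set.ext_iff.1 h2 k |>.1 trivial rfl
  rw [← ncard_maxRank (y 0).pos y, ← hinj.ncard_image, ← Set.ncard_union_eq hdisj]
  refine Set.ncard_le_ncard (Set.union_subset (maxRank_subset hG) ?_)
  rintro _ ⟨k, hk, rfl⟩
  exact (hg k hk).1

theorem isLeast_rank (hs0 : 0 < s) (hs : s + 1 < n) (y : Fin (s + 1) ↪o Fin n) :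
    IsLeast {k : ℕ | ∃ G : Set (OnY n (Set.range y)), Subsemigroup.closure G = ⊤ ∧ G.ncard = k}
      ((n - 1).choose s + (captiveIndices y).ncard) := by
  have := finite_OnY (Set.range y)
  constructor
  · obtain ⟨ε, hε⟩ := exists_generating_set hs0 hs y
    refine ⟨_, hε, le_antisymm ?_ (le_ncard_of_closure_eq_top hs0 y hε)⟩
    rw [← ncard_maxRank (y 0).pos y]
    exact (Set.ncard_union_le _ _).trans (Nat.add_le_add_left Set.ncard_image_le _)
  · rintro _ ⟨G, hG, rfl⟩
    exact le_ncard_of_closure_eq_top hs0 y hG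

end OnY

/-- The rank of `O_n(Y)` (the least cardinality of a generating set) equals
`C(n-1, r-1) + |Y^♯|`, where `r = |Y|`, `1 < r < n`, and `Y^♯` is the set of
captive elements of `Y`. -/
theorem rank_of_OnY
    (n r : ℕ) (Y : Set (Fin n)) (hr1 : 1 < r) (hrn : r < n) (hYr : Y.ncard = r) :
    IsLeast
      {k : ℕ | ∃ G : Set (OnY n Y), Subsemigroup.closure G = ⊤ ∧ G.ncard = k}
      (Nat.choose (n - 1) (r - 1) + {y ∈ Y | Captive n Y y}.ncard) := by
  obtain ⟨s, rfl⟩ : ∃ s, r = s + 1 := ⟨r - 1, by omega⟩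
  classical
  rw [Set.ncard_eq_toFinset_card'] at hYr
  obtain ⟨y, rfl⟩ : ∃ y : Fin (s + 1) ↪o Fin n, Set.range y = Y :=
    ⟨Y.toFinset.orderEmbOfFin hYr, by rw [Finset.range_orderEmbOfFin, Set.coe_toFinset]⟩
  have himg : {x ∈ Set.range y | Captive n (Set.range y) x} = y '' OnY.captiveIndices y := by
    ext x
    constructor
    · rintro ⟨⟨k, rfl⟩, hk⟩
      exact ⟨k, hk, rfl⟩
    · rintro ⟨k, hk, rfl⟩
      exact ⟨⟨k, rfl⟩, hk⟩
  rw [himg, Set.ncard_image_of_injective _ y.injective, Nat.add_sub_cancel]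
  exact OnY.isLeast_rank (by omega) hrn y
end
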